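/- arXiv:2411.13493 — 3 statements merged into one kernel-verified Lean document; each statement's English description precedes it below -/
import Mathlib

section
/- For every pair of F₂^k-valued random variables X and Y and every pair of finitely-valued random variables A and B (with (X,A) and (Y,B) jointly distributed), there exists an F₂-linear subspace 𝒢 ⊆ F₂^k such that d(Y|B, U_𝒢) ≤ 7·d(X|A, Y|B), where U_𝒢 is a uniform random variable on 𝒢. -/
open MeasureTheory

/-- Base-2 Shannon entropy of a random variable `X` (with finitely many values)
on the probability space `(Ω, μ)`: `H(X) = -∑ₛ P(X = s) log₂ P(X = s)`. -/
noncomputable def ent {Ω S : Type*} [MeasurableSpace Ω] (μ : Measure Ω) (X : Ω → S) : ℝ :=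
  -∑' s : S, (μ (X ⁻¹' {s})).toReal * Real.logb 2 (μ (X ⁻¹' {s})).toReal

/-- Conditional entropy `H(X|Y) = H(X,Y) - H(Y)`. -/
noncomputable def condEnt {Ω S T : Type*} [MeasurableSpace Ω] (μ : Measure Ω)
    (X : Ω → S) (Y : Ω → T) : ℝ :=
  ent μ (fun ω => (X ω, Y ω)) - ent μ Y

/-- Conditional Ruzsa distance
`d(X|A, Y|B) = H(X' + Y' | A', B') - (H(X'|A') + H(Y'|B'))/2`, where `(X', A')` and
`(Y', B')` are independent copies of `(X, A)` and `(Y, B)` (realized on the product space). -/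
noncomputable def condRdist {Ω₁ Ω₂ G S T : Type*} [MeasurableSpace Ω₁] [MeasurableSpace Ω₂]
    [Add G] (μ₁ : Measure Ω₁) (μ₂ : Measure Ω₂)
    (X : Ω₁ → G) (A : Ω₁ → S) (Y : Ω₂ → G) (B : Ω₂ → T) : ℝ :=
  condEnt (μ₁.prod μ₂) (fun ω => X ω.1 + Y ω.2) (fun ω => (A ω.1, B ω.2))
    - (condEnt μ₁ X A + condEnt μ₂ Y B) / 2

/-- The uniform probability measure on a (finite, nonempty) type: normalized counting measure. -/
noncomputable def unifM (α : Type*) [MeasurableSpace α] : Measure α :=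
  (Measure.count (Set.univ : Set α))⁻¹ • Measure.count

/-! ### Entropy of functions on a finite weighted space -/

set_option linter.unusedSectionVars false

namespace WeightedEntropy

open Finset Real

section Law

variable {Ω Ω' R S T : Type*} [Fintype Ω] [Fintype Ω'] [Fintype R] [Fintype S] [Fintype T]

open scoped Classical in
/-- The push-forward of the weight `w` under `X`. -/
noncomputable def law (w : Ω → ℝ) (X : Ω → S) (s : S) : ℝ :=
  ∑ ω, if X ω = s then w ω else 0

/-- The product weight. -/
def tens (w : Ω → ℝ) (v : Ω' → ℝ) (x : Ω × Ω') : ℝ := w x.1 * v x.2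

/-- Shannon entropy, in nats, of `X` under the weight `w`. -/
noncomputable def H (w : Ω → ℝ) (X : Ω → S) : ℝ := ∑ s, negMulLog (law w X s)

/-- The conditional law of `X` given `Z = z`. -/
noncomputable def condLaw (w : Ω → ℝ) (X : Ω → S) (Z : Ω → T) (z : T) (s : S) : ℝ :=
  law w (fun ω => (X ω, Z ω)) (s, z) / law w Z z

/-- `X` and `Y` are conditionally independent given `Z`. -/
def CondIndep (w : Ω → ℝ) (X : Ω → R) (Y : Ω → S) (Z : Ω → T) : Prop :=
  ∀ z, law w Z z ≠ 0 →
    condLaw w (fun ω => (X ω, Y ω)) Z z = tens (condLaw w X Z z) (condLaw w Y Z z)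

/-- `X` and `Y` are independent. -/
def Indep (w : Ω → ℝ) (X : Ω → R) (Y : Ω → S) : Prop :=
  law w (fun ω => (X ω, Y ω)) = tens (law w X) (law w Y)

lemma law_nonneg {w : Ω → ℝ} (hw : ∀ ω, 0 ≤ w ω) (X : Ω → S) (s : S) : 0 ≤ law w X s :=
  sum_nonneg fun ω _ => by split_ifs <;> simp [hw]

lemma sum_law_mul (w : Ω → ℝ) (X : Ω → S) (φ : S → ℝ) :
    ∑ s, law w X s * φ s = ∑ ω, w ω * φ (X ω) := by
  classical
  simp only [law, sum_mul]
  rw [sum_comm]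
  refine sum_congr rfl fun ω _ => ?_
  rw [sum_eq_single (X ω)] <;> simp +contextual [eq_comm]

lemma sum_law (w : Ω → ℝ) (X : Ω → S) : ∑ s, law w X s = ∑ ω, w ω := by
  simpa using sum_law_mul w X 1

lemma law_mem {w : Ω → ℝ} (hw : w ∈ stdSimplex ℝ Ω) (X : Ω → S) :
    law w X ∈ stdSimplex ℝ S :=
  ⟨law_nonneg hw.1 X, by rw [sum_law, hw.2]⟩

lemma tens_mem {w : Ω → ℝ} {v : Ω' → ℝ} (hw : w ∈ stdSimplex ℝ Ω) (hv : v ∈ stdSimplex ℝ Ω') :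
    tens w v ∈ stdSimplex ℝ (Ω × Ω') :=
  ⟨fun x => mul_nonneg (hw.1 _) (hv.1 _), by
    simp only [tens, Fintype.sum_prod_type, ← mul_sum, hv.2, mul_one, hw.2]⟩

lemma law_law (w : Ω → ℝ) (X : Ω → S) (f : S → T) :
    law (law w X) f = law w (fun ω => f (X ω)) := by
  classical
  ext t
  have := sum_law_mul w X fun s => if f s = t then 1 else 0
  simpa [law] using this

lemma law_eq_single (w : Ω → ℝ) (X : Ω → S) (s : S) (ω₀ : Ω) (h : ∀ ω, X ω = s ↔ ω = ω₀) :
    law w X s = w ω₀ := by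
  classical
  simp [law, h]

lemma law_eq_of_injective {w : Ω → ℝ} {X : Ω → S} (hX : Function.Injective X) (ω : Ω) :
    law w X (X ω) = w ω :=
  law_eq_single w X _ ω fun _ => hX.eq_iff

lemma law_id (w : Ω → ℝ) : law w (fun ω => ω) = w :=
  funext fun ω => law_eq_of_injective (w := w) (X := fun ω => ω) (fun _ _ h => h) ω

lemma le_law {w : Ω → ℝ} (hw : ∀ ω, 0 ≤ w ω) (X : Ω → S) (ω : Ω) : w ω ≤ law w X (X ω) := by
  classical
  have := single_le_sum (f := fun ω' => if X ω' = X ω then w ω' else 0)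
    (fun ω' _ => by split_ifs <;> simp [hw]) (mem_univ ω)
  simpa [law] using this

lemma law_tens {w : Ω → ℝ} {v : Ω' → ℝ} (F : Ω × Ω' → T) (X : Ω → R) (Y : Ω' → S)
    (t : T) (r : R) (s : S) (h : ∀ x, F x = t ↔ X x.1 = r ∧ Y x.2 = s) :
    law (tens w v) F t = law w X r * law v Y s := by
  classical
  simp only [law, tens, Fintype.sum_prod_type, h, sum_mul_sum, ite_and]
  refine sum_congr rfl fun x _ => sum_congr rfl fun y _ => ?_
  split_ifs <;> simp

lemma law_tens_map (w : Ω → ℝ) (v : Ω' → ℝ) (X : Ω → S) (Y : Ω' → T) :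
    law (tens w v) (fun x => (X x.1, Y x.2)) = tens (law w X) (law v Y) := by
  ext ⟨s, t⟩
  exact law_tens _ X Y _ _ _ (by simp)

lemma law_const {w : Ω → ℝ} (hw : w ∈ stdSimplex ℝ Ω) (s : S) : law w (fun _ => s) s = 1 := by
  simpa [law] using hw.2

lemma law_tens_fst (w : Ω → ℝ) {v : Ω' → ℝ} (hv : v ∈ stdSimplex ℝ Ω') (X : Ω → S) :
    law (tens w v) (fun x => X x.1) = law w X := by
  ext s
  rw [law_tens _ X (fun _ => ()) s s () (by simp), law_const hv, mul_one]

lemma law_tens_snd {w : Ω → ℝ} (hw : w ∈ stdSimplex ℝ Ω) (v : Ω' → ℝ) (X : Ω' → S) :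
    law (tens w v) (fun x => X x.2) = law v X := by
  ext s
  rw [law_tens _ (fun _ => ()) X s () s (by simp), law_const hw, one_mul]

lemma sum_law_pair (w : Ω → ℝ) (X : Ω → S) (Z : Ω → T) (z : T) :
    ∑ s, law w (fun ω => (X ω, Z ω)) (s, z) = law w Z z := by
  classical
  simp only [law]
  rw [sum_comm]
  refine sum_congr rfl fun ω _ => ?_
  rw [sum_eq_single (X ω)] <;> simp +contextual [eq_comm]

end Law

section Entropy

variable {Ω Ω' R S T : Type*} [Fintype Ω] [Fintype Ω'] [Fintype R] [Fintype S] [Fintype T]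
  {w : Ω → ℝ} {v : Ω' → ℝ}

lemma H_eq_sum (w : Ω → ℝ) (X : Ω → S) : H w X = -∑ ω, w ω * log (law w X (X ω)) := by
  rw [← sum_law_mul w X fun s => log (law w X s)]
  simp [H, negMulLog, sum_neg_distrib]

lemma H_law (w : Ω → ℝ) (X : Ω → S) (f : S → T) : H (law w X) f = H w fun ω => f (X ω) := by
  simp only [H, law_law]

/-- The entropy of `X` depends only on the partition into level sets of `X`. -/
lemma H_congr (X : Ω → S) (Y : Ω → T)
    (h : ∀ ω ω', w ω ≠ 0 → w ω' ≠ 0 → (X ω = X ω' ↔ Y ω = Y ω')) : H w X = H w Y := by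
  classical
  rw [H_eq_sum, H_eq_sum]
  congr 1
  refine sum_congr rfl fun ω _ => ?_
  by_cases hω : w ω = 0
  · simp [hω]
  congr 2
  refine sum_congr rfl fun ω' _ => ?_
  by_cases hω' : w ω' = 0
  · simp [hω']
  simp only [h ω' ω hω' hω]

lemma H_const (hw : w ∈ stdSimplex ℝ Ω) (s : S) : H w (fun _ => s) = 0 := by
  simp [H_eq_sum, law_const hw]

/-- Strong subadditivity of entropy. -/
lemma H_submod (hw : w ∈ stdSimplex ℝ Ω) (X : Ω → R) (Y : Ω → S) (Z : Ω → T) :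
    H w (fun ω => (X ω, Y ω, Z ω)) + H w Z
      ≤ H w (fun ω => (X ω, Z ω)) + H w (fun ω => (Y ω, Z ω)) := by
  set P := law w fun ω => (X ω, Y ω, Z ω) with hP
  set Q := law w fun ω => (X ω, Z ω) with hQ
  set V := law w fun ω => (Y ω, Z ω) with hV
  set C := law w Z with hC
  have key : ∀ t : R × S × T, P t * (log (Q (t.1, t.2.2)) + log (V t.2) - log (P t)
      - log (C t.2.2)) ≤ Q (t.1, t.2.2) * V t.2 / C t.2.2 - P t := by
    rintro ⟨x, y, z⟩
    have hQ0 := law_nonneg hw.1 (fun ω => (X ω, Z ω)) (x, z)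
    have hV0 := law_nonneg hw.1 (fun ω => (Y ω, Z ω)) (y, z)
    have hC0 := law_nonneg hw.1 Z z
    have hP0 := law_nonneg hw.1 (fun ω => (X ω, Y ω, Z ω)) (x, y, z)
    rw [← hQ] at hQ0; rw [← hV] at hV0; rw [← hC] at hC0; rw [← hP] at hP0
    rcases hP0.eq_or_lt with h0 | hP0
    · simp only [← h0, zero_mul, sub_zero]; positivity
    have e1 : law P (fun t => (t.1, t.2.2)) = Q := law_law _ _ _
    have e2 : law P (fun t => t.2) = V := law_law _ _ _
    have e3 : law P (fun t => t.2.2) = C := law_law _ _ _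
    have hPn := law_nonneg hw.1 (fun ω => (X ω, Y ω, Z ω))
    have l1 := le_law hPn (fun t => (t.1, t.2.2)) (x, y, z)
    have l2 := le_law hPn (fun t => t.2) (x, y, z)
    have l3 := le_law hPn (fun t => t.2.2) (x, y, z)
    rw [← hP] at l1 l2 l3
    rw [e1] at l1; rw [e2] at l2; rw [e3] at l3
    have p1 := hP0.trans_le l1
    have p2 := hP0.trans_le l2
    have p3 := hP0.trans_le l3
    dsimp only at p1 p2 p3 ⊢
    have hlog := log_le_sub_one_of_pos
      (show 0 < Q (x, z) * V (y, z) / (P (x, y, z) * C z) by positivity)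
    rw [log_div (by positivity) (by positivity), log_mul (by positivity) (by positivity),
      log_mul (by positivity) (by positivity)] at hlog
    have := mul_le_mul_of_nonneg_left hlog hP0.le
    calc _ = P (x, y, z) * (log (Q (x, z)) + log (V (y, z)) - (log (P (x, y, z)) + log (C z))) := by
          ring
      _ ≤ _ := this
      _ = _ := by field_simp
  have hsum := sum_le_sum fun t (_ : t ∈ univ) => key t
  have hr : ∑ t : R × S × T, (Q (t.1, t.2.2) * V t.2 / C t.2.2 - P t) ≤ 0 := by
    rw [sum_sub_distrib, hP, sum_law, hw.2]
    have : ∑ t : R × S × T, Q (t.1, t.2.2) * V t.2 / C t.2.2 = ∑ z, C z * C z / C z := by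
      simp only [Fintype.sum_prod_type]
      rw [sum_comm]
      calc _ = ∑ y, ∑ z, (∑ x, Q (x, z)) * V (y, z) / C z := by
            refine sum_congr rfl fun y _ => ?_
            rw [sum_comm]; simp only [← sum_div, ← sum_mul]
        _ = _ := by
            rw [sum_comm]
            refine sum_congr rfl fun z _ => ?_
            rw [hQ, hV, sum_law_pair, ← sum_div, ← mul_sum, sum_law_pair]
    rw [this]
    have : ∑ z, C z * C z / C z = 1 := by
      rw [← hw.2, ← sum_law w Z]
      exact sum_congr rfl fun z _ => by rw [mul_self_div_self]
    rw [this, sub_self]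
  have hl : ∑ t : R × S × T, P t * (log (Q (t.1, t.2.2)) + log (V t.2) - log (P t)
      - log (C t.2.2)) = -H w (fun ω => (X ω, Z ω)) - H w (fun ω => (Y ω, Z ω))
        + H w (fun ω => (X ω, Y ω, Z ω)) + H w Z := by
    rw [hP, sum_law_mul w (fun ω => (X ω, Y ω, Z ω)) fun t => log (Q (t.1, t.2.2)) + log (V t.2)
      - log (law w (fun ω => (X ω, Y ω, Z ω)) t) - log (C t.2.2)]
    simp only [H_eq_sum, mul_sub, mul_add, sum_sub_distrib, sum_add_distrib]
    ring
  linarith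

lemma H_subadd (hw : w ∈ stdSimplex ℝ Ω) (X : Ω → R) (Y : Ω → S) :
    H w (fun ω => (X ω, Y ω)) ≤ H w X + H w Y := by
  have := H_submod hw X Y fun _ => ()
  rw [H_const hw, H_congr (fun ω => (X ω, Y ω, ())) (fun ω => (X ω, Y ω)) (by simp),
    H_congr (fun ω => (X ω, ())) X (by simp), H_congr (fun ω => (Y ω, ())) Y (by simp)] at this
  linarith

lemma condLaw_mem (hw : w ∈ stdSimplex ℝ Ω) (X : Ω → S) (Z : Ω → T) {z : T}
    (hz : law w Z z ≠ 0) : condLaw w X Z z ∈ stdSimplex ℝ S :=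
  ⟨fun s => div_nonneg (law_nonneg hw.1 _ _) (law_nonneg hw.1 _ _), by
    simp only [condLaw]
    rw [← sum_div, sum_law_pair, div_self hz]⟩

lemma condLaw_comp (w : Ω → ℝ) (X : Ω → S) (Z : Ω → T) (z : T) (f : S → R) :
    condLaw w (fun ω => f (X ω)) Z z = law (condLaw w X Z z) f := by
  classical
  ext r
  have h : law w (fun ω => (f (X ω), Z ω)) (r, z)
      = ∑ s, if f s = r then law w (fun ω => (X ω, Z ω)) (s, z) else 0 := by
    simp only [law, Prod.mk.injEq]
    simp only [← sum_filter]
    rw [sum_comm' (t' := univ.filter fun ω => f (X ω) = r ∧ Z ω = z) (s' := fun ω => {X ω})]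
    · simp
    · intro s ω; simp only [mem_filter, mem_univ, true_and, mem_singleton]; grind
  rw [condLaw, h, sum_div]
  exact sum_congr rfl fun s _ => by simp only [condLaw]; split_ifs <;> simp

/-- The chain rule, with the conditional entropy written as an average. -/
lemma H_pair (hw : w ∈ stdSimplex ℝ Ω) (X : Ω → S) (Z : Ω → T) :
    H w (fun ω => (X ω, Z ω)) = H w Z + ∑ z, law w Z z * H (condLaw w X Z z) fun s => s := by
  have e : ∀ s z, law w (fun ω => (X ω, Z ω)) (s, z) = law w Z z * condLaw w X Z z s := by
    intro s z
    by_cases hz : law w Z z = 0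
    · have h1 := sum_law_pair w X Z z
      rw [hz, sum_eq_zero_iff_of_nonneg fun s _ => law_nonneg hw.1 _ _] at h1
      rw [h1 s (mem_univ s), hz, zero_mul]
    · rw [condLaw, mul_div_cancel₀ _ hz]
  simp only [H, law_id, Fintype.sum_prod_type, e, negMulLog_mul]
  rw [sum_comm, ← sum_add_distrib]
  refine sum_congr rfl fun z _ => ?_
  rw [sum_add_distrib, ← sum_mul, ← mul_sum]
  by_cases hz : law w Z z = 0
  · simp [hz]
  · rw [(condLaw_mem hw X Z hz).2, one_mul]

lemma H_tens (hw : w ∈ stdSimplex ℝ Ω) (hv : v ∈ stdSimplex ℝ Ω') (X : Ω → S) (Y : Ω' → T) :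
    H (tens w v) (fun x => (X x.1, Y x.2)) = H w X + H v Y := by
  simp only [H, law_tens_map]
  simp only [tens, negMulLog_mul, Fintype.sum_prod_type, sum_add_distrib, ← mul_sum, ← sum_mul,
    (law_mem hw X).2, (law_mem hv Y).2, one_mul]

lemma H_tens_fst (w : Ω → ℝ) (hv : v ∈ stdSimplex ℝ Ω') (X : Ω → S) :
    H (tens w v) (fun x => X x.1) = H w X := by
  simp only [H, law_tens_fst w hv]

lemma H_tens_snd (hw : w ∈ stdSimplex ℝ Ω) (v : Ω' → ℝ) (X : Ω' → S) :
    H (tens w v) (fun x => X x.2) = H v X := by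
  simp only [H, law_tens_snd hw]

lemma Indep.comp {R' S' : Type*} [Fintype R'] [Fintype S'] {X : Ω → R} {Y : Ω → S}
    (h : Indep w X Y) (f : R → R') (g : S → S') :
    Indep w (fun ω => f (X ω)) (fun ω => g (Y ω)) := by
  unfold Indep at *
  rw [← law_law w (fun ω => (X ω, Y ω)) fun t => (f t.1, g t.2), h, law_tens_map, law_law, law_law]

lemma Indep.H_pair (hw : w ∈ stdSimplex ℝ Ω) {X : Ω → R} {Y : Ω → S} (h : Indep w X Y) :
    H w (fun ω => (X ω, Y ω)) = H w X + H w Y := by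
  have := H_tens (law_mem hw X) (law_mem hw Y) (fun x => x) fun y => y
  rwa [← h, H_law, H_law, H_law] at this

lemma CondIndep.comp {R' S' : Type*} [Fintype R'] [Fintype S'] {X : Ω → R} {Y : Ω → S} {Z : Ω → T}
    (h : CondIndep w X Y Z) (f : R → R') (g : S → S') :
    CondIndep w (fun ω => f (X ω)) (fun ω => g (Y ω)) Z := by
  intro z hz
  rw [condLaw_comp w (fun ω => (X ω, Y ω)) Z z fun t => (f t.1, g t.2), h z hz, law_tens_map,
    condLaw_comp w X, condLaw_comp w Y]

lemma CondIndep.H_triple (hw : w ∈ stdSimplex ℝ Ω) {X : Ω → R} {Y : Ω → S} {Z : Ω → T}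
    (h : CondIndep w X Y Z) :
    H w (fun ω => ((X ω, Y ω), Z ω)) + H w Z
      = H w (fun ω => (X ω, Z ω)) + H w (fun ω => (Y ω, Z ω)) := by
  rw [WeightedEntropy.H_pair hw (fun ω => (X ω, Y ω)), WeightedEntropy.H_pair hw X,
    WeightedEntropy.H_pair hw Y]
  have : ∀ z, law w Z z * H (condLaw w (fun ω => (X ω, Y ω)) Z z) (fun s => s)
      = law w Z z * H (condLaw w X Z z) (fun s => s)
        + law w Z z * H (condLaw w Y Z z) (fun s => s) := by
    intro z
    by_cases hz : law w Z z = 0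
    · simp [hz]
    rw [h z hz, ← mul_add,
      ← H_tens (condLaw_mem hw X Z hz) (condLaw_mem hw Y Z hz) (fun s => s) fun s => s]
  simp only [this, sum_add_distrib]
  ring

lemma condIndep_tens (w : Ω → ℝ) (v : Ω' → ℝ) (f : Ω → S) (g : Ω' → T) :
    CondIndep (tens w v) (fun x => x.1) (fun x => x.2) (fun x => (f x.1, g x.2)) := by
  rintro ⟨s, t⟩ hz
  ext ⟨a, b⟩
  simp only [condLaw]
  rw [law_tens (fun x => (f x.1, g x.2)) f g _ s t (by simp)] at hz ⊢
  rw [tens, condLaw, condLaw, law_tens (fun x => (f x.1, g x.2)) f g _ s t (by simp),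
    law_tens (fun x : Ω × Ω' => ((x.1, x.2), (f x.1, g x.2))) (fun x => (x, f x))
      (fun x => (x, g x)) _ (a, s) (b, t) (by simp; tauto),
    law_tens (fun x : Ω × Ω' => (x.1, (f x.1, g x.2))) (fun x => (x, f x)) g _ (a, s) t
      (by simp; tauto),
    law_tens (fun x : Ω × Ω' => (x.2, (f x.1, g x.2))) f (fun x => (x, g x)) _ s (b, t)
      (by simp; tauto)]
  have h1 := left_ne_zero_of_mul hz
  have h2 := right_ne_zero_of_mul hz
  field_simp

lemma CondIndep.of_law {Q : Type*} [Fintype Q] {F : Ω → Q} {X : Q → R} {Y : Q → S} {Z : Q → T}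
    (h : CondIndep (law w F) X Y Z) :
    CondIndep w (fun ω => X (F ω)) (fun ω => Y (F ω)) (fun ω => Z (F ω)) := by
  intro z hz
  have := h z
  simp only [condLaw, law_law, funext_iff] at this ⊢
  simpa [condLaw, law_law, tens] using this hz

lemma Indep.condIndep {R' S' : Type*} [Fintype R'] [Fintype S'] {X : Ω → R} {Y : Ω → S}
    (h : Indep w X Y) (f : R → R') (g : S → S') :
    CondIndep w X Y (fun ω => (f (X ω), g (Y ω))) := by
  have := condIndep_tens (law w X) (law w Y) f g
  rw [← h] at this
  exact this.of_law

lemma H_tens_swap (w : Ω → ℝ) (v : Ω' → ℝ) (X : Ω × Ω' → S) :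
    H (tens v w) (fun x => X (x.2, x.1)) = H (tens w v) X := by
  have : tens w v = law (tens v w) Prod.swap := by
    ext ⟨a, b⟩
    rw [law_eq_single _ _ _ (b, a) (by rintro ⟨c, d⟩; simp [Prod.ext_iff, and_comm])]
    simp [tens, mul_comm]
  rw [this, H_law]
  rfl

end Entropy

section Ruzsa

variable {Ω Ω' R S T G : Type*} [Fintype Ω] [Fintype Ω'] [Fintype R] [Fintype S] [Fintype T]
  [AddCommGroup G] [Fintype G] {w : Ω → ℝ} {y : G × T → ℝ}

/-- The Ruzsa distance between two distributions. -/
noncomputable def rdist (p q : G → ℝ) : ℝ :=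
  H (tens p q) (fun x => x.1 + x.2) - (H p (fun g => g) + H q (fun g => g)) / 2

/-- The Ruzsa distance from `A` conditioned on `Z` to the first coordinate of a `y`-distributed
pair conditioned on the second one. -/
noncomputable def rho (y : G × T → ℝ) (w : Ω → ℝ) (A : Ω → G) (Z : Ω → S) : ℝ :=
  H (tens w y) (fun x => ((A x.1 + x.2.1, x.2.2), Z x.1)) - H w Z - H y (fun v => v.2)
    - (H w (fun ω => (A ω, Z ω)) - H w Z) / 2 - (H y (fun v => v) - H y (fun v => v.2)) / 2

/-- The unconditioned distance from the distribution `p` to `y`. -/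
noncomputable def rho₀ (y : G × T → ℝ) (p : G → ℝ) : ℝ := rho y p (fun g => g) fun _ => ()

lemma rho_law (y : G × T → ℝ) (w : Ω → ℝ) (F : Ω → R) (A : R → G) (Z : R → S) :
    rho y (law w F) A Z = rho y w (fun ω => A (F ω)) (fun ω => Z (F ω)) := by
  have : tens (law w F) y = law (tens w y) fun x => (F x.1, x.2) := by
    rw [law_tens_map w y F fun v => v, law_id]
  simp only [rho, this, H_law]

lemma rho_congr (A : Ω → G) (Z : Ω → S) (Z' : Ω → R)
    (h : ∀ ω ω', w ω ≠ 0 → w ω' ≠ 0 → (Z ω = Z ω' ↔ Z' ω = Z' ω')) :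
    rho y w A Z = rho y w A Z' := by
  rw [rho, rho, H_congr Z Z' h,
    H_congr (fun ω => (A ω, Z ω)) (fun ω => (A ω, Z' ω))
      fun ω ω' h1 h2 => by simp only [Prod.mk.injEq, h ω ω' h1 h2],
    H_congr (w := tens w y) (fun x => ((A x.1 + x.2.1, x.2.2), Z x.1))
      (fun x => ((A x.1 + x.2.1, x.2.2), Z' x.1))
      fun x x' h1 h2 => by
        simp only [Prod.mk.injEq, h x.1 x'.1 (left_ne_zero_of_mul h1) (left_ne_zero_of_mul h2)]]

lemma rho₀_law (A : Ω → G) (Z : Ω → S) (hZ : ∀ ω ω', Z ω = Z ω') :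
    rho₀ y (law w A) = rho y w A Z := by
  rw [rho₀, rho_law]
  exact rho_congr _ _ _ fun ω ω' _ _ => by simp [hZ ω ω']

/-- Conditioning increases the distance by at most half of the entropy drop. -/
lemma rho_cond_le (hw : w ∈ stdSimplex ℝ Ω) (hy : y ∈ stdSimplex ℝ (G × T)) (A : Ω → G)
    (Z : Ω → R) (C : Ω → S) :
    rho y w A (fun ω => (Z ω, C ω)) ≤ rho y w A C + (H w (fun ω => (A ω, C ω)) - H w C
      - H w (fun ω => (A ω, Z ω, C ω)) + H w (fun ω => (Z ω, C ω))) / 2 := by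
  have h := H_submod (tens_mem hw hy) (fun x => (A x.1 + x.2.1, x.2.2)) (fun x => Z x.1)
    fun x => C x.1
  rw [H_tens_fst w hy C, H_tens_fst w hy fun ω => (Z ω, C ω)] at h
  simp only [rho]
  linarith

/-- Adding an independent variable increases the distance by at most half of the entropy gain. -/
lemma rho_add_le (hw : w ∈ stdSimplex ℝ Ω) (hy : y ∈ stdSimplex ℝ (G × T)) {A B : Ω → G}
    (hAB : Indep w A B) :
    rho y w (fun ω => A ω + B ω) (fun _ => ()) ≤ rho y w A (fun _ => ())
      + (H w (fun ω => A ω + B ω) - H w A) / 2 := by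
  have hwy := tens_mem hw hy
  have h := H_submod hwy (fun x => B x.1) (fun x => A x.1 + B x.1)
    fun x => (A x.1 + B x.1 + x.2.1, x.2.2)
  have h1 : H (tens w y) (fun x => (B x.1, A x.1 + B x.1, A x.1 + B x.1 + x.2.1, x.2.2))
      = H w A + H w B + H y (fun v => v) := by
    rw [← hAB.H_pair hw, ← H_tens hw hy]
    refine H_congr _ _ fun x x' _ _ => ?_
    simp only [Prod.ext_iff]
    constructor
    · rintro ⟨e1, e2, e3, e4⟩
      rw [e1] at e2
      rw [e1, add_right_cancel e2] at e3
      exact ⟨⟨add_right_cancel e2, e1⟩, add_left_cancel e3, e4⟩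
    · rintro ⟨⟨e1, e2⟩, e3, e4⟩
      simp [e1, e2, e3, e4]
  have h2 : H (tens w y) (fun x => (B x.1, A x.1 + B x.1 + x.2.1, x.2.2))
      ≤ H w B + H (tens w y) (fun x => (A x.1 + x.2.1, x.2.2)) := by
    rw [← H_tens_fst w hy B]
    refine le_of_eq_of_le (H_congr _ _ fun x x' _ _ => ?_) (H_subadd hwy _ _)
    simp only [Prod.mk.injEq]
    refine and_congr_right fun e => ?_
    rw [e, add_right_comm, add_right_comm (A x'.1), add_left_inj]
  have h3 : H (tens w y) (fun x => (A x.1 + B x.1, A x.1 + B x.1 + x.2.1, x.2.2))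
      ≤ H w (fun ω => A ω + B ω) + H y (fun v => v) := by
    rw [← H_tens hw hy]
    refine le_of_eq (H_congr _ _ fun x x' _ _ => ?_)
    simp only [Prod.ext_iff]
    refine and_congr_right fun e => ?_
    rw [e, add_right_inj]
  have e1 : ∀ D : Ω → G, H (tens w y) (fun x => ((D x.1 + x.2.1, x.2.2), ()))
      = H (tens w y) (fun x => (D x.1 + x.2.1, x.2.2)) := fun D => H_congr _ _ (by simp)
  have e2 : ∀ D : Ω → G, H w (fun ω => (D ω, ())) = H w D := fun D => H_congr _ _ (by simp)
  simp only [rho]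
  rw [e1 A, e1 fun ω => A ω + B ω, e2 A, e2 fun ω => A ω + B ω]
  linarith

/-- The conditional distance is an average of unconditional ones. -/
lemma rho_eq_sum (hw : w ∈ stdSimplex ℝ Ω) (hy : y ∈ stdSimplex ℝ (G × T)) (A : Ω → G)
    (Z : Ω → S) : rho y w A Z = ∑ z, law w Z z * rho₀ y (condLaw w A Z z) := by
  have h0 : ∀ z, law w Z z * rho₀ y (condLaw w A Z z)
      = law w Z z * H (condLaw (tens w y) (fun x => (A x.1 + x.2.1, x.2.2)) (fun x => Z x.1) z)
          (fun s => s)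
        - law w Z z * H (condLaw w A Z z) (fun s => s) / 2
        - law w Z z * (H y (fun v => v) + H y (fun v => v.2)) / 2 := by
    intro z
    by_cases hz : law w Z z = 0
    · simp [hz]
    have hc := condLaw_mem hw A Z hz
    have e : condLaw (tens w y) (fun x => (A x.1, x.2)) (fun x => Z x.1) z
        = tens (condLaw w A Z z) y := by
      ext ⟨a, v⟩
      simp only [condLaw, tens]
      rw [law_tens_fst w hy, law_tens (fun x : Ω × G × T => ((A x.1, x.2), Z x.1))
        (fun ω => (A ω, Z ω)) (fun v => v) _ (a, z) v (by simp; tauto), law_id]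
      ring
    rw [condLaw_comp (tens w y) (fun x => (A x.1, x.2)) (fun x => Z x.1) z
      fun s => (s.1 + s.2.1, s.2.2), e, H_law, rho₀, rho, H_const hc,
      H_congr (fun x : G × G × T => ((x.1 + x.2.1, x.2.2), ())) (fun x => (x.1 + x.2.1, x.2.2))
        (by simp), H_congr (fun g : G => (g, ())) (fun g => g) (by simp)]
    ring
  simp only [h0, sum_sub_distrib, ← sum_div, ← sum_mul]
  rw [sum_law, hw.2, rho, WeightedEntropy.H_pair hw A Z,
    WeightedEntropy.H_pair (tens_mem hw hy) (fun x => (A x.1 + x.2.1, x.2.2)) (fun x => Z x.1),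
    H_tens_fst w hy, law_tens_fst w hy]
  ring

/-- A lower bound for the functional `rdist p q + η * (rho₀ p + rho₀ q)` passes to conditionally
independent variables. -/
lemma le_of_condIndep (hw : w ∈ stdSimplex ℝ Ω) (hy : y ∈ stdSimplex ℝ (G × T)) {η τ : ℝ}
    (hmin : ∀ p ∈ stdSimplex ℝ G, ∀ q ∈ stdSimplex ℝ G,
      τ ≤ rdist p q + η * (rho₀ y p + rho₀ y q))
    {A B : Ω → G} {Z : Ω → S} (h : CondIndep w A B Z) :
    τ ≤ H w (fun ω => (A ω + B ω, Z ω))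
      - (H w (fun ω => (A ω, Z ω)) + H w (fun ω => (B ω, Z ω))) / 2
      + η * (rho y w A Z + rho y w B Z) := by
  have key : ∀ z, law w Z z * τ ≤ law w Z z * H (condLaw w (fun ω => A ω + B ω) Z z) (fun s => s)
      - (law w Z z * H (condLaw w A Z z) (fun s => s)
        + law w Z z * H (condLaw w B Z z) (fun s => s)) / 2
      + η * (law w Z z * rho₀ y (condLaw w A Z z) + law w Z z * rho₀ y (condLaw w B Z z)) := by
    intro z
    by_cases hz : law w Z z = 0
    · simp [hz]
    have := mul_le_mul_of_nonneg_left
      (hmin _ (condLaw_mem hw A Z hz) _ (condLaw_mem hw B Z hz)) (law_nonneg hw.1 Z z)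
    rw [condLaw_comp w (fun ω => (A ω, B ω)) Z z fun s => s.1 + s.2, h z hz, H_law]
    rw [rdist] at this
    linarith
  have hs := sum_le_sum fun z (_ : z ∈ univ) => key z
  simp only [sum_add_distrib, sum_sub_distrib, ← sum_div, ← mul_sum, ← sum_mul] at hs
  rw [sum_law, hw.2, ← rho_eq_sum hw hy, ← rho_eq_sum hw hy] at hs
  rw [WeightedEntropy.H_pair hw A, WeightedEntropy.H_pair hw B,
    WeightedEntropy.H_pair hw fun ω => A ω + B ω]
  linarith

end Ruzsa

section Coupling

variable {Ω S : Type*} [Fintype Ω] [Fintype S] {w : Ω → ℝ}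

open scoped Classical in
/-- The coupling of two copies of `w` that are conditionally independent given `Z`. -/
noncomputable def coupling (w : Ω → ℝ) (Z : Ω → S) (x : Ω × Ω) : ℝ :=
  if Z x.1 = Z x.2 then w x.1 * w x.2 / law w Z (Z x.1) else 0

lemma eq_of_coupling_ne_zero {Z : Ω → S} {x : Ω × Ω} (h : coupling w Z x ≠ 0) :
    Z x.1 = Z x.2 := by
  by_contra hne
  exact h (by simp [coupling, hne])

lemma law_coupling_fst (hw : w ∈ stdSimplex ℝ Ω) (Z : Ω → S) :
    law (coupling w Z) (fun x => x.1) = w := by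
  classical
  ext ω
  have h : law (coupling w Z) (fun x => x.1) ω
      = w ω / law w Z (Z ω) * ∑ ω', if Z ω' = Z ω then w ω' else 0 := by
    simp only [law, coupling, Fintype.sum_prod_type, mul_sum]
    rw [sum_eq_single ω (fun b _ hb => by simp [hb]) (by simp)]
    refine sum_congr rfl fun ω' _ => ?_
    by_cases e : Z ω = Z ω'
    · simp [e]; ring
    · simp [e, Ne.symm e]
  rw [h]
  by_cases h0 : w ω = 0
  · simp [h0]
  have hpos : law w Z (Z ω) ≠ 0 :=
    ((lt_of_le_of_ne (hw.1 ω) (Ne.symm h0)).trans_le (le_law hw.1 Z ω)).ne'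
  change w ω / law w Z (Z ω) * law w Z (Z ω) = w ω
  field_simp

lemma law_coupling_snd (hw : w ∈ stdSimplex ℝ Ω) (Z : Ω → S) :
    law (coupling w Z) (fun x => x.2) = w := by
  classical
  refine Eq.trans ?_ (law_coupling_fst hw Z)
  ext ω
  simp only [law, Fintype.sum_prod_type]
  rw [sum_comm]
  refine sum_congr rfl fun a _ => sum_congr rfl fun b _ => ?_
  by_cases e : Z a = Z b
  · simp [coupling, e, mul_comm]
  · simp [coupling, e, Ne.symm e]

lemma coupling_mem (hw : w ∈ stdSimplex ℝ Ω) (Z : Ω → S) :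
    coupling w Z ∈ stdSimplex ℝ (Ω × Ω) := by
  refine ⟨fun x => ?_, ?_⟩
  · unfold coupling
    split_ifs
    · exact div_nonneg (mul_nonneg (hw.1 _) (hw.1 _)) (law_nonneg hw.1 _ _)
    · rfl
  · rw [← sum_law _ fun x => x.1, law_coupling_fst hw, hw.2]

lemma condIndep_coupling (hw : w ∈ stdSimplex ℝ Ω) (Z : Ω → S) :
    CondIndep (coupling w Z) (fun x => x.1) (fun x => x.2) (fun x => Z x.1) := by
  classical
  intro z hz
  have e : law (coupling w Z) (fun x => Z x.1) = law w Z := by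
    rw [← law_law (coupling w Z) (fun x => x.1) Z, law_coupling_fst hw]
  have e1 : ∀ a, law (coupling w Z) (fun x => (x.1, Z x.1)) (a, z) = if Z a = z then w a else 0 := by
    intro a
    rw [← law_law (coupling w Z) (fun x => x.1) (fun a => (a, Z a)), law_coupling_fst hw]
    split_ifs with h
    · exact law_eq_single _ _ _ _ (by simp +contextual [← h])
    · refine sum_eq_zero fun ω _ => if_neg ?_
      simp only [Prod.mk.injEq]; rintro ⟨rfl, h'⟩; exact h h'
  have e2 : ∀ a, law (coupling w Z) (fun x => (x.2, Z x.1)) (a, z) = if Z a = z then w a else 0 := by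
    intro a
    rw [← e1 a, ← law_law (coupling w Z) (fun x => x.1) (fun a => (a, Z a)), law_coupling_fst hw]
    conv_rhs => rw [← law_coupling_snd hw Z, law_law]
    refine sum_congr rfl fun x _ => ?_
    by_cases h0 : coupling w Z x = 0
    · simp [h0]
    · simp [eq_of_coupling_ne_zero h0]
  ext ⟨a, b⟩
  simp only [condLaw, tens, e1, e2, e]
  rw [e] at hz
  have e3 : law (coupling w Z) (fun x => ((x.1, x.2), Z x.1)) ((a, b), z)
      = if Z a = z then coupling w Z (a, b) else 0 := by
    split_ifs with h
    · exact law_eq_single _ _ _ _ (by rintro ⟨c, d⟩; simp [← h]; rintro rfl _; rfl)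
    · refine sum_eq_zero fun ω _ => if_neg ?_
      simp only [Prod.mk.injEq]; rintro ⟨⟨rfl, _⟩, h'⟩; exact h h'
  rw [e3]
  by_cases h1 : Z a = z
  · subst h1
    by_cases h2 : Z a = Z b
    · simp [coupling, h2]; ring
    · simp [coupling, h2, Ne.symm h2]
  · simp [h1]

end Coupling

section Minimizer

variable {Ω R S T G : Type*} [Fintype Ω] [Fintype R] [Fintype S] [Fintype T]
  [AddCommGroup G] [Fintype G] {w : Ω → ℝ} {y : G × T → ℝ} {η τ : ℝ}

lemma H_coupling_fst (hw : w ∈ stdSimplex ℝ Ω) (Z : Ω → S) (X : Ω → R) :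
    H (coupling w Z) (fun x => X x.1) = H w X := by
  rw [← H_law (coupling w Z) (fun x => x.1) X, law_coupling_fst hw]

lemma H_coupling_snd (hw : w ∈ stdSimplex ℝ Ω) (Z : Ω → S) (X : Ω → R) :
    H (coupling w Z) (fun x => X x.2) = H w X := by
  rw [← H_law (coupling w Z) (fun x => x.2) X, law_coupling_snd hw]

/-- An entropic Balog–Szemerédi–Gowers inequality, combined with a lower bound for the functional
`rdist p q + η * (rho₀ p + rho₀ q)`. -/
lemma le_of_conditioning_on_sum (h2 : ∀ g : G, g + g = 0) (hw : w ∈ stdSimplex ℝ Ω)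
    (hy : y ∈ stdSimplex ℝ (G × T)) (hη : 0 ≤ η)
    (hmin : ∀ p ∈ stdSimplex ℝ G, ∀ q ∈ stdSimplex ℝ G,
      τ ≤ rdist p q + η * (rho₀ y p + rho₀ y q))
    (A B : Ω → G) (C : Ω → S) :
    τ ≤ 2 * H w (fun ω => (A ω, C ω)) + 2 * H w (fun ω => (B ω, C ω))
      + 2 * H w (fun ω => (A ω + B ω, C ω)) - 3 * H w (fun ω => (A ω, B ω, C ω)) - 3 * H w C
      + η * (rho y w A C + rho y w B C
        + (H w (fun ω => (A ω, C ω)) + H w (fun ω => (B ω, C ω))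
          + 2 * H w (fun ω => (A ω + B ω, C ω)) - 2 * H w (fun ω => (A ω, B ω, C ω))
          - 2 * H w C) / 2) := by
  set Z : Ω → G × S := fun ω => (A ω + B ω, C ω) with hZ
  set W := coupling w Z with hW
  have hWm : W ∈ stdSimplex ℝ (Ω × Ω) := coupling_mem hw Z
  have hci : CondIndep W (fun x => x.1) (fun x => x.2) (fun x => Z x.1) :=
    condIndep_coupling hw Z
  have supp : ∀ x, W x ≠ 0 → A x.1 + B x.1 = A x.2 + B x.2 ∧ C x.1 = C x.2 := fun x hx => by
    simpa [hZ] using eq_of_coupling_ne_zero hx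
  have supp' : ∀ x, W x ≠ 0 → A x.1 + B x.2 = A x.2 + B x.1 := fun x hx => by
    have e := (supp x hx).1
    calc A x.1 + B x.2 = (A x.1 + B x.1) + B x.2 - B x.1 := by abel
      _ = A x.2 + (B x.2 + B x.2) + (B x.1 - (B x.1 + B x.1)) := by rw [e]; abel
      _ = A x.2 + B x.1 := by rw [h2, h2]; abel
  have main := le_of_condIndep hWm hy hmin (hci.comp A B)
  have hAZ : H w (fun ω => (A ω, Z ω)) = H w (fun ω => (A ω, B ω, C ω)) :=
    H_congr _ _ fun ω ω' _ _ => by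
      simp only [hZ, Prod.mk.injEq]
      exact and_congr_right fun e => by rw [e, add_right_inj]
  have hBZ : H w (fun ω => (B ω, Z ω)) = H w (fun ω => (A ω, B ω, C ω)) :=
    H_congr _ _ fun ω ω' _ _ => by
      simp only [hZ, Prod.mk.injEq]
      rw [← and_assoc, ← and_assoc, and_comm (a := A ω = A ω')]
      exact and_congr_left' (and_congr_right fun e => by rw [e, add_left_inj])
  have e1 : H W (fun x => (A x.1, Z x.1)) = H w (fun ω => (A ω, B ω, C ω)) := by
    rw [H_coupling_fst hw Z fun ω => (A ω, Z ω), hAZ]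
  have e2 : H W (fun x => (B x.2, Z x.1)) = H w (fun ω => (A ω, B ω, C ω)) := by
    rw [← hBZ, ← H_coupling_snd hw Z fun ω => (B ω, Z ω)]
    exact H_congr _ _ fun x x' hx hx' => by
      rw [eq_of_coupling_ne_zero hx, eq_of_coupling_ne_zero hx']
  have r1 : rho y W (fun x => A x.1) (fun x => Z x.1) = rho y w A Z := by
    rw [← rho_law y W (fun x => x.1) A Z, hW, law_coupling_fst hw]
  have r2 : rho y W (fun x => B x.2) (fun x => Z x.1) = rho y w B Z := by
    rw [rho_congr (fun x : Ω × Ω => B x.2) (fun x => Z x.1) (fun x => Z x.2)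
      fun x x' hx hx' => by rw [eq_of_coupling_ne_zero hx, eq_of_coupling_ne_zero hx'],
      ← rho_law y W (fun x => x.2) B Z, hW, law_coupling_snd hw]
  have r3 := rho_cond_le hw hy A (fun ω => A ω + B ω) C
  have r4 := rho_cond_le hw hy B (fun ω => A ω + B ω) C
  have s1 := H_submod hWm (fun x => A x.1 + B x.2) (fun x => A x.1 + B x.1) fun x => C x.1
  have s2 := H_submod hWm (fun x => A x.1) (fun x => B x.1) fun x => (A x.1 + B x.2, C x.1)
  have s3 := H_submod hWm (fun x => A x.1) (fun x => B x.2) fun x => C x.1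
  have s4 := H_submod hWm (fun x => A x.2) (fun x => B x.1) fun x => C x.1
  have full := (hci.comp (fun ω => (A ω, B ω, C ω)) (fun ω => (A ω, B ω, C ω))).H_triple hWm
  have f1 : H W (fun x => (A x.1 + B x.2, A x.1 + B x.1, C x.1))
      = H W (fun x => (A x.1 + B x.2, Z x.1)) := rfl
  have f2 : H W (fun x => (((A x.1, B x.1, C x.1), (A x.2, B x.2, C x.2)), Z x.1))
      = H W (fun x => (A x.1, B x.1, A x.1 + B x.2, C x.1)) :=
    H_congr _ _ fun x x' hx hx' => by
      obtain ⟨u1, u2⟩ := supp x hx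
      obtain ⟨v1, v2⟩ := supp x' hx'
      simp only [hZ, Prod.mk.injEq]
      constructor
      · rintro ⟨⟨⟨a1, b1, c1⟩, a2, b2, c2⟩, -⟩
        exact ⟨a1, b1, by rw [a1, b2], c1⟩
      · rintro ⟨a1, b1, ab, c1⟩
        have b2 : B x.2 = B x'.2 := by rwa [a1, add_right_inj] at ab
        rw [a1, b1, v1, b2, add_left_inj] at u1
        exact ⟨⟨⟨a1, b1, c1⟩, u1.symm, b2, by rw [← u2, ← v2, c1]⟩, by rw [a1, b1], c1⟩
  have f3 : H W (fun x => (A x.1, A x.1 + B x.2, C x.1)) = H W (fun x => (A x.1, B x.2, C x.1)) :=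
    H_congr _ _ fun x x' _ _ => by
      simp only [Prod.mk.injEq]
      exact and_congr_right fun e => by rw [e, add_right_inj]
  have f4 : H W (fun x => (B x.1, A x.1 + B x.2, C x.1)) = H W (fun x => (A x.2, B x.1, C x.1)) :=
    H_congr _ _ fun x x' hx hx' => by
      rw [supp' x hx, supp' x' hx']
      simp only [Prod.mk.injEq]
      rw [← and_assoc, ← and_assoc, and_comm (a := A x.2 = A x'.2)]
      exact and_congr_left' (and_congr_right fun e => by rw [e, add_left_inj])
  have f5 : H W (fun x => (B x.2, C x.1)) = H w (fun ω => (B ω, C ω)) := by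
    rw [← H_coupling_snd hw Z fun ω => (B ω, C ω)]
    exact H_congr _ _ fun x x' hx hx' => by rw [(supp x hx).2, (supp x' hx').2]
  have f6 : H W (fun x => (A x.2, C x.1)) = H w (fun ω => (A ω, C ω)) := by
    rw [← H_coupling_snd hw Z fun ω => (A ω, C ω)]
    exact H_congr _ _ fun x x' hx hx' => by rw [(supp x hx).2, (supp x' hx').2]
  have f7 : H W (fun x => ((A x.1, B x.1, C x.1), Z x.1)) = H w (fun ω => (A ω, B ω, C ω)) := by
    rw [← H_coupling_fst hw Z fun ω => (A ω, B ω, C ω)]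
    exact H_congr _ _ fun x x' _ _ => by
      simp only [hZ, Prod.mk.injEq]
      exact and_iff_left_of_imp fun ⟨a, b, c⟩ => ⟨by rw [a, b], c⟩
  have f8 : H W (fun x => ((A x.2, B x.2, C x.2), Z x.1)) = H w (fun ω => (A ω, B ω, C ω)) := by
    rw [← H_coupling_snd hw Z fun ω => (A ω, B ω, C ω)]
    exact H_congr _ _ fun x x' hx hx' => by
      rw [eq_of_coupling_ne_zero hx, eq_of_coupling_ne_zero hx']
      simp only [hZ, Prod.mk.injEq]
      exact and_iff_left_of_imp fun ⟨a, b, c⟩ => ⟨by rw [a, b], c⟩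
  have f9 := H_coupling_fst hw Z C
  have f10 := H_coupling_fst hw Z Z
  have f11 := H_coupling_fst hw Z fun ω => (A ω, C ω)
  have f12 := H_coupling_fst hw Z fun ω => (B ω, C ω)
  rw [e1, e2, r1, r2] at main
  rw [f2, f7, f8, f10] at full
  rw [f1, f9, show H W (fun x => (A x.1 + B x.1, C x.1)) = H w Z from f10] at s1
  rw [f3, f4] at s2
  rw [f9, f11, f5] at s3
  rw [f9, f6, f12] at s4
  have hA' : H w (fun ω => (A ω, A ω + B ω, C ω)) = H w (fun ω => (A ω, B ω, C ω)) := hAZ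
  have hB' : H w (fun ω => (B ω, A ω + B ω, C ω)) = H w (fun ω => (A ω, B ω, C ω)) := hBZ
  rw [hA'] at r3
  rw [hB'] at r4
  have hr := mul_le_mul_of_nonneg_left (add_le_add r3 r4) hη
  change _ ≤ _ + η * (rho y w A Z + rho y w B Z) at main
  change η * (rho y w A Z + rho y w B Z) ≤ _ at hr
  change τ ≤ 2 * H w (fun ω => (A ω, C ω)) + 2 * H w (fun ω => (B ω, C ω))
      + 2 * H w Z - 3 * H w (fun ω => (A ω, B ω, C ω)) - 3 * H w C + η * _
  refine main.trans ?_
  have : η * (rho y w A Z + rho y w B Z) ≤ η * (rho y w A C + rho y w B C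
        + (H w (fun ω => (A ω, C ω)) + H w (fun ω => (B ω, C ω))
          + 2 * H w Z - 2 * H w (fun ω => (A ω, B ω, C ω)) - 2 * H w C) / 2) := by
    refine hr.trans (le_of_eq ?_)
    ring
  linarith

lemma rho_le_rho₀ (hw : w ∈ stdSimplex ℝ Ω) (hy : y ∈ stdSimplex ℝ (G × T)) (A : Ω → G)
    (Z : Ω → S) : rho y w A Z ≤ rho₀ y (law w A)
      + (H w A - H w (fun ω => (A ω, Z ω)) + H w Z) / 2 := by
  have h := rho_cond_le hw hy A Z fun _ => ()
  rw [H_const hw, ← rho₀_law A (fun _ => ()) (by simp),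
    rho_congr A (fun ω => (Z ω, ())) Z (by simp), H_congr (fun ω => (A ω, ())) A (by simp),
    H_congr (fun ω => (A ω, Z ω, ())) (fun ω => (A ω, Z ω)) (by simp),
    H_congr (fun ω => (Z ω, ())) Z (by simp)] at h
  linarith

lemma rho₀_add_le (hy : y ∈ stdSimplex ℝ (G × T)) {p q : G → ℝ} (hp : p ∈ stdSimplex ℝ G)
    (hq : q ∈ stdSimplex ℝ G) :
    rho₀ y (law (tens p q) fun x => x.1 + x.2)
      ≤ rho₀ y p + (H (tens p q) (fun x => x.1 + x.2) - H p fun g => g) / 2 ∧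
    rho₀ y (law (tens p q) fun x => x.1 + x.2)
      ≤ rho₀ y q + (H (tens p q) (fun x => x.1 + x.2) - H q fun g => g) / 2 := by
  have e1 : law (tens p q) (fun x => x.1) = p := (law_tens_fst p hq fun g => g).trans (law_id p)
  have e2 : law (tens p q) (fun x => x.2) = q := (law_tens_snd hp q fun g => g).trans (law_id q)
  have hpq := tens_mem hp hq
  have i1 : Indep (tens p q) (fun x => x.1) (fun x => x.2) := by
    rw [Indep, e1, e2]
    exact law_id _
  have i2 : Indep (tens p q) (fun x => x.2) (fun x => x.1) := by
    rw [Indep, e1, e2]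
    ext ⟨a, b⟩
    rw [law_eq_single _ _ _ (b, a) (by rintro ⟨c, d⟩; simp [and_comm])]
    simp [tens, mul_comm]
  have h1 := rho_add_le hpq hy i1
  have h2 := rho_add_le hpq hy i2
  have c : (fun x : G × G => x.2 + x.1) = fun x => x.1 + x.2 := funext fun x => add_comm _ _
  rw [c] at h2
  rw [← rho₀_law _ _ (by simp), ← rho₀_law _ _ (by simp)] at h1 h2
  rw [e1, ← H_tens_fst p hq fun g => g] at *
  rw [e2, ← H_tens_snd hp q fun g => g] at *
  exact ⟨h1, h2⟩

lemma le_of_indep (hmin : ∀ p ∈ stdSimplex ℝ G, ∀ q ∈ stdSimplex ℝ G,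
      τ ≤ rdist p q + η * (rho₀ y p + rho₀ y q)) (hw : w ∈ stdSimplex ℝ Ω) {A B : Ω → G}
    (h : Indep w A B) : τ ≤ H w (fun ω => A ω + B ω) - (H w A + H w B) / 2
      + η * (rho₀ y (law w A) + rho₀ y (law w B)) := by
  have := hmin _ (law_mem hw A) _ (law_mem hw B)
  rwa [rdist, ← h, H_law, H_law, H_law] at this

end Minimizer

section FourVariables

variable {Ω R S T G : Type*} [Fintype Ω] [Fintype R] [Fintype S] [Fintype T]
  [AddCommGroup G] [Fintype G] {w : Ω → ℝ} {y : G × T → ℝ} {τ : ℝ}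

lemma indep_of_law_pair {X : Ω → R} {Y : Ω → S} {p : R → ℝ} {q : S → ℝ}
    (hp : p ∈ stdSimplex ℝ R) (hq : q ∈ stdSimplex ℝ S)
    (h : law w (fun ω => (X ω, Y ω)) = tens p q) :
    law w X = p ∧ law w Y = q ∧ Indep w X Y := by
  have hX : law w X = p := by
    rw [← law_law w (fun ω => (X ω, Y ω)) Prod.fst, h, ← law_id p]
    simpa only [law_id] using law_tens_fst p hq fun s => s
  have hY : law w Y = q := by
    rw [← law_law w (fun ω => (X ω, Y ω)) Prod.snd, h, ← law_id q]
    simpa only [law_id] using law_tens_snd hp q fun s => s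
  exact ⟨hX, hY, by rw [Indep, h, hX, hY]⟩

/-- The entropies determined by two independent pairs `(A, B)` and `(C, D)` of distributions
`tens p q` and `tens p' q'`. -/
lemma entropies_of_law {p q p' q' : G → ℝ} (hp : p ∈ stdSimplex ℝ G) (hq : q ∈ stdSimplex ℝ G)
    (hp' : p' ∈ stdSimplex ℝ G) (hq' : q' ∈ stdSimplex ℝ G) (hw : w ∈ stdSimplex ℝ Ω)
    {A B C D : Ω → G}
    (h : law w (fun ω => ((A ω, B ω), (C ω, D ω))) = tens (tens p q) (tens p' q')) :
    law w (fun ω => A ω + B ω) = law (tens p q) (fun x => x.1 + x.2) ∧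
    law w (fun ω => C ω + D ω) = law (tens p' q') (fun x => x.1 + x.2) ∧
    Indep w (fun ω => A ω + B ω) (fun ω => C ω + D ω) ∧
    H w (fun ω => (A ω + B ω, C ω + D ω))
      = H (tens p q) (fun x => x.1 + x.2) + H (tens p' q') (fun x => x.1 + x.2) ∧
    H w (fun ω => (A ω, A ω + B ω, C ω + D ω))
      = H p (fun g => g) + H q (fun g => g) + H (tens p' q') (fun x => x.1 + x.2) ∧
    H w (fun ω => (D ω, A ω + B ω, C ω + D ω))
      = H p' (fun g => g) + H q' (fun g => g) + H (tens p q) (fun x => x.1 + x.2) ∧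
    CondIndep w A D (fun ω => (A ω + B ω, C ω + D ω)) ∧
    H w (fun ω => (A ω + B ω, A ω + B ω + (C ω + D ω)))
      = H (tens p q) (fun x => x.1 + x.2) + H (tens p' q') (fun x => x.1 + x.2) ∧
    H w (fun ω => (C ω + D ω, A ω + B ω + (C ω + D ω)))
      = H (tens p q) (fun x => x.1 + x.2) + H (tens p' q') (fun x => x.1 + x.2) := by
  obtain ⟨e1, e2, ind⟩ := indep_of_law_pair (tens_mem hp hq) (tens_mem hp' hq') h
  have l1 : law w (fun ω => A ω + B ω) = law (tens p q) (fun x => x.1 + x.2) := by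
    rw [← e1, law_law]
  have l2 : law w (fun ω => C ω + D ω) = law (tens p' q') (fun x => x.1 + x.2) := by
    rw [← e2, law_law]
  have H1 : H w (fun ω => A ω + B ω) = H (tens p q) (fun x => x.1 + x.2) := by rw [← e1, H_law]
  have H2 : H w (fun ω => C ω + D ω) = H (tens p' q') (fun x => x.1 + x.2) := by rw [← e2, H_law]
  have H3 : H w (fun ω => (A ω, B ω)) = H p (fun g => g) + H q (fun g => g) := by
    rw [← H_tens hp hq, ← e1, H_law]
  have H4 : H w (fun ω => (C ω, D ω)) = H p' (fun g => g) + H q' (fun g => g) := by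
    rw [← H_tens hp' hq', ← e2, H_law]
  have i0 := ind.comp (fun x => x.1 + x.2) (fun x => x.1 + x.2)
  have i1 := ind.comp (fun x => x) (fun x => x.1 + x.2)
  have i2 := ind.comp (fun x => x.1 + x.2) (fun x => x)
  have P0 : H w (fun ω => (A ω + B ω, C ω + D ω))
      = H (tens p q) (fun x => x.1 + x.2) + H (tens p' q') (fun x => x.1 + x.2) := by
    rw [← H1, ← H2, ← i0.H_pair hw]
  refine ⟨l1, l2, i0, P0, ?_, ?_,
    (ind.condIndep (fun x => x.1 + x.2) (fun x => x.1 + x.2)).comp Prod.fst Prod.snd, ?_, ?_⟩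
  · rw [← H3, ← H2, ← i1.H_pair hw]
    refine H_congr _ _ fun ω ω' _ _ => ?_
    simp only [Prod.mk.injEq, ← and_assoc]
    exact and_congr_left' (and_congr_right fun e => by rw [e, add_right_inj])
  · rw [← H4, ← H1, add_comm, ← i2.H_pair hw]
    refine H_congr _ _ fun ω ω' _ _ => ?_
    simp only [Prod.mk.injEq]
    rw [and_left_comm, and_comm (b := D ω = D ω')]
    exact and_congr_right' (and_congr_right fun e => by rw [e, add_left_inj])
  · rw [← P0]
    refine H_congr _ _ fun ω ω' _ _ => ?_
    simp only [Prod.mk.injEq]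
    exact and_congr_right fun e => by rw [e, add_right_inj]
  · rw [← P0]
    refine H_congr _ _ fun ω ω' _ _ => ?_
    simp only [Prod.mk.injEq]
    rw [and_comm (a := A ω + B ω = A ω' + B ω')]
    exact and_congr_right fun e => by rw [e, add_left_inj]

end FourVariables

section Endgame

variable {Ω T G : Type*} [Fintype Ω] [Fintype T]
  [AddCommGroup G] [Fintype G] {w : Ω → ℝ} {y : G × T → ℝ} {τ : ℝ}

lemma H_eq_of_comp {R S : Type*} [Fintype R] [Fintype S] {X : Ω → R} {Y : Ω → S} (f : S → R)
    (g : R → S) (hf : ∀ ω, X ω = f (Y ω)) (hg : ∀ ω, Y ω = g (X ω)) : H w X = H w Y :=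
  H_congr _ _ fun ω ω' _ _ =>
    ⟨fun e => by rw [hg, hg, e], fun e => by rw [hf, hf, e]⟩

/-- At a minimizer of the functional `rdist p q + (rho₀ p + rho₀ q) / 11`, the distance of `p` and
`q` vanishes. -/
lemma rdist_nonpos_of_minimizer (h2 : ∀ g : G, g + g = 0) (hy : y ∈ stdSimplex ℝ (G × T))
    {p q : G → ℝ} (hp : p ∈ stdSimplex ℝ G) (hq : q ∈ stdSimplex ℝ G)
    (hmin : ∀ p' ∈ stdSimplex ℝ G, ∀ q' ∈ stdSimplex ℝ G,
      rdist p q + 1 / 11 * (rho₀ y p + rho₀ y q)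
        ≤ rdist p' q' + 1 / 11 * (rho₀ y p' + rho₀ y q')) :
    rdist p q ≤ 0 := by
  set W := tens p (tens q (tens p q)) with hW
  have hWm : W ∈ stdSimplex ℝ (G × G × G × G) := tens_mem hp (tens_mem hq (tens_mem hp hq))
  obtain ⟨x₁, h₁⟩ : ∃ f : G × G × G × G → G, f = fun x => x.1 := ⟨_, rfl⟩
  obtain ⟨x₂, h₂⟩ : ∃ f : G × G × G × G → G, f = fun x => x.2.1 := ⟨_, rfl⟩
  obtain ⟨x₃, h₃⟩ : ∃ f : G × G × G × G → G, f = fun x => x.2.2.1 := ⟨_, rfl⟩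
  obtain ⟨x₄, h₄⟩ : ∃ f : G × G × G × G → G, f = fun x => x.2.2.2 := ⟨_, rfl⟩
  have I1 : law W (fun ω => ((x₁ ω, x₄ ω), (x₃ ω, x₂ ω))) = tens (tens p q) (tens p q) := by
    subst h₁ h₂ h₃ h₄
    ext ⟨⟨a, b⟩, c, d⟩
    rw [law_eq_single _ _ _ (a, d, c, b) (by rintro ⟨a', b', c', d'⟩; simp; tauto)]
    simp only [tens, hW]; ring
  have I2 : law W (fun ω => ((x₁ ω, x₂ ω), (x₃ ω, x₄ ω))) = tens (tens p q) (tens p q) := by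
    subst h₁ h₂ h₃ h₄
    ext ⟨⟨a, b⟩, c, d⟩
    rw [law_eq_single _ _ _ (a, b, c, d) (by rintro ⟨a', b', c', d'⟩; simp; tauto)]
    simp only [tens, hW]; ring
  have I3 : law W (fun ω => ((x₁ ω, x₃ ω), (x₄ ω, x₂ ω))) = tens (tens p p) (tens q q) := by
    subst h₁ h₂ h₃ h₄
    ext ⟨⟨a, b⟩, c, d⟩
    rw [law_eq_single _ _ _ (a, d, b, c) (by rintro ⟨a', b', c', d'⟩; simp; tauto)]
    simp only [tens, hW]; ring
  have L1 : law W x₁ = p := by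
    rw [h₁, hW, law_tens_fst p (tens_mem hq (tens_mem hp hq)) fun g => g, law_id]
  have L2 : law W x₂ = q := by
    rw [h₂, hW, law_tens_snd hp _ fun x : G × G × G => x.1,
      law_tens_fst q (tens_mem hp hq) fun g => g, law_id]
  have N1 : H W x₁ = H p fun g => g := by rw [← L1, H_law]
  have N2 : H W x₂ = H q fun g => g := by rw [← L2, H_law]
  clear_value W
  clear h₁ h₂ h₃ h₄ hW
  obtain ⟨a1, a2, a3, a4, a5, a6, a7, a8, a9⟩ := entropies_of_law hp hq hp hq hWm I1
  obtain ⟨b1, b2, b3, b4, b5, b6, b7, b8, b9⟩ := entropies_of_law hp hq hp hq hWm I2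
  obtain ⟨c1, c2, c3, c4, c5, c6, c7, c8, c9⟩ := entropies_of_law hp hp hq hq hWm I3
  obtain ⟨s, hs⟩ : ∃ s : G × G × G × G → G, ∀ ω, x₁ ω + x₄ ω + (x₃ ω + x₂ ω) = s ω :=
    ⟨_, fun _ => rfl⟩
  have hs2 : ∀ ω, x₁ ω + x₂ ω + (x₃ ω + x₄ ω) = s ω := fun ω => by rw [← hs]; abel
  have hs3 : ∀ ω, x₁ ω + x₃ ω + (x₄ ω + x₂ ω) = s ω := fun ω => by rw [← hs]; abel
  have uv : ∀ ω, x₁ ω + x₂ ω + (x₃ ω + x₂ ω) = x₁ ω + x₃ ω := fun ω => by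
    rw [← add_zero (x₁ ω + x₃ ω), ← h2 (x₂ ω)]; abel
  have vd : ∀ ω, x₃ ω + x₂ ω + (x₁ ω + x₃ ω) = x₁ ω + x₂ ω := fun ω => by
    rw [← add_zero (x₁ ω + x₂ ω), ← h2 (x₃ ω)]; abel
  have ud : ∀ ω, x₁ ω + x₂ ω + (x₁ ω + x₃ ω) = x₃ ω + x₂ ω := fun ω => by
    rw [← add_zero (x₃ ω + x₂ ω), ← h2 (x₁ ω)]; abel
  have ve : ∀ ω, x₃ ω + x₂ ω + (x₄ ω + x₂ ω) = x₃ ω + x₄ ω := fun ω => by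
    rw [← add_zero (x₃ ω + x₄ ω), ← h2 (x₂ ω)]; abel
  simp only [hs] at a8 a9
  simp only [hs2] at b8 b9
  simp only [hs3] at c8 c9
  have Ea : H W (fun ω => (x₁ ω + x₂ ω, x₁ ω + x₄ ω, x₃ ω + x₂ ω))
      = H W fun ω => (x₁ ω + x₂ ω, x₃ ω + x₂ ω, s ω) :=
    H_eq_of_comp (fun t => (t.1, t.2.2 - t.2.1, t.2.1)) (fun t => (t.1, t.2.2, t.2.1 + t.2.2))
      (fun ω => by simp [← hs]) (fun ω => by simp [← hs])
  have Ed : H W (fun ω => (x₁ ω + x₂ ω, x₁ ω + x₃ ω, x₄ ω + x₂ ω))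
      = H W fun ω => (x₁ ω + x₂ ω, x₃ ω + x₂ ω, s ω) :=
    H_eq_of_comp (fun t => (t.1, t.1 + t.2.1, t.2.2 - (t.1 + t.2.1)))
      (fun t => (t.1, t.1 + t.2.1, t.2.1 + t.2.2))
      (fun ω => by simp [← hs3, uv]) (fun ω => by simp [← hs3, ud])
  have Ef : H W (fun ω => (x₃ ω + x₂ ω, x₁ ω + x₃ ω, s ω))
      = H W fun ω => (x₁ ω + x₂ ω, x₃ ω + x₂ ω, s ω) :=
    H_eq_of_comp (fun t => (t.2.1, t.1 + t.2.1, t.2.2))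
      (fun t => (t.1 + t.2.1, t.1, t.2.2)) (fun ω => by simp [uv]) (fun ω => by simp [vd])
  have Eg : H W (fun ω => (x₃ ω + x₂ ω, x₄ ω + x₂ ω, s ω))
      = H W fun ω => (x₁ ω + x₂ ω, x₃ ω + x₂ ω, s ω) :=
    H_eq_of_comp (fun t => (t.2.1, t.2.2 - (t.1 + t.2.1), t.2.2))
      (fun t => (t.1 + (t.2.2 - t.2.1), t.1, t.2.2))
      (fun ω => by simp [← hs3, uv]) (fun ω => by simp [← hs3, vd])
  have ia := le_of_condIndep hWm hy hmin a7
  have ra1 := rho_le_rho₀ hWm hy x₁ fun ω => (x₁ ω + x₄ ω, x₃ ω + x₂ ω)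
  have ra2 := rho_le_rho₀ hWm hy x₂ fun ω => (x₁ ω + x₄ ω, x₃ ω + x₂ ω)
  have ib := le_of_indep hmin hWm a3
  have ic := le_of_indep hmin hWm c3
  have idd := le_of_condIndep hWm hy hmin c7
  have rd1 := rho_le_rho₀ hWm hy x₁ fun ω => (x₁ ω + x₃ ω, x₄ ω + x₂ ω)
  have rd2 := rho_le_rho₀ hWm hy x₂ fun ω => (x₁ ω + x₃ ω, x₄ ω + x₂ ω)
  have η0 : (0 : ℝ) ≤ 1 / 11 := by norm_num
  have ie := le_of_conditioning_on_sum h2 hWm hy η0 hmin (fun ω => x₁ ω + x₂ ω)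
    (fun ω => x₃ ω + x₂ ω) s
  have if' := le_of_conditioning_on_sum h2 hWm hy η0 hmin (fun ω => x₃ ω + x₂ ω)
    (fun ω => x₁ ω + x₃ ω) s
  have ig := le_of_conditioning_on_sum h2 hWm hy η0 hmin (fun ω => x₃ ω + x₂ ω)
    (fun ω => x₄ ω + x₂ ω) s
  have rU := rho_le_rho₀ hWm hy (fun ω => x₁ ω + x₂ ω) s
  have rV := rho_le_rho₀ hWm hy (fun ω => x₃ ω + x₂ ω) s
  have r13 := rho_le_rho₀ hWm hy (fun ω => x₁ ω + x₃ ω) s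
  have r24 := rho_le_rho₀ hWm hy (fun ω => x₄ ω + x₂ ω) s
  obtain ⟨t1, t2⟩ := rho₀_add_le hy hp hq
  obtain ⟨t3, -⟩ := rho₀_add_le hy hp hp
  obtain ⟨t4, -⟩ := rho₀_add_le hy hq hq
  have HU : H W (fun ω => x₁ ω + x₂ ω) = H (tens p q) (fun x => x.1 + x.2) := by
    simpa only [H_law] using congrArg (H · fun g => g) b1
  have HV : H W (fun ω => x₃ ω + x₂ ω) = H (tens p q) (fun x => x.1 + x.2) := by
    simpa only [H_law] using congrArg (H · fun g => g) a2
  have H14 : H W (fun ω => x₁ ω + x₄ ω) = H (tens p q) (fun x => x.1 + x.2) := by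
    simpa only [H_law] using congrArg (H · fun g => g) a1
  have H13 : H W (fun ω => x₁ ω + x₃ ω) = H (tens p p) (fun x => x.1 + x.2) := by
    simpa only [H_law] using congrArg (H · fun g => g) c1
  have H24 : H W (fun ω => x₄ ω + x₂ ω) = H (tens q q) (fun x => x.1 + x.2) := by
    simpa only [H_law] using congrArg (H · fun g => g) c2
  simp only [uv, vd, ve, hs, hs3, L1, L2, N1, N2, HU, HV, H14, H13, H24, Ea, Ed, Ef, Eg, a1,
    a2, b1, c1, c2, a4, a5, a6, a9, b8, b9, c4, c5, c6, c8, c9]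
    at ia ra1 ra2 ib ic idd rd1 rd2 ie if' ig rU rV r13 r24
  rw [rdist] at *
  clear a1 a2 a3 a4 a5 a6 a7 a8 a9 b1 b2 b3 b4 b5 b6 b7 b8 b9 c1 c2 c3 c4 c5 c6 c7 c8 c9 Ea Ed Ef
    Eg HU HV H14 H13 H24 I1 I2 I3 hs hs2 hs3 uv vd ve ud L1 L2 N1 N2 hmin
  linarith

end Endgame

section Structure

variable {S T G : Type*} [Fintype S] [Fintype T] [AddCommGroup G] [Fintype G]
  {y : G × T → ℝ} {p q : G → ℝ}

lemma H_self (p : G → ℝ) : H p (fun g => g) = ∑ g, negMulLog (p g) := by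
  rw [H, law_id]

lemma law_add (p q : G → ℝ) (g : G) :
    law (tens p q) (fun x => x.1 + x.2) g = ∑ b, q b • p (g - b) := by
  classical
  simp only [law, tens, Fintype.sum_prod_type]
  rw [sum_comm]
  refine sum_congr rfl fun b _ => ?_
  simp [← eq_sub_iff_add_eq, mul_comm]

/-- Convolving with `q` does not increase the entropy of `p` only if all the translates of `p` by
elements of the support of `q` agree. -/
lemma translate_eq_of_H_add_le (hp : p ∈ stdSimplex ℝ G) (hq : q ∈ stdSimplex ℝ G)
    (h : H (tens p q) (fun x => x.1 + x.2) ≤ H p fun g => g) {b c : G} (hb : q b ≠ 0)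
    (hc : q c ≠ 0) (g : G) : p (g - b) = p (g - c) := by
  have key : ∀ g ∈ (univ : Finset G), ∑ b, q b • negMulLog (p (g - b))
      ≤ negMulLog (∑ b, q b • p (g - b)) := fun g _ =>
    concaveOn_negMulLog.le_map_sum (fun b _ => hq.1 b) hq.2 fun b _ => hp.1 _
  have e : ∑ g, ∑ b, q b • negMulLog (p (g - b)) = H p fun g => g := by
    rw [sum_comm]
    have : ∀ b, ∑ g, negMulLog (p (g - b)) = ∑ g, negMulLog (p g) := fun b =>
      (Equiv.subRight b).sum_comp fun g => negMulLog (p g)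
    simp only [← smul_sum, this]
    rw [← sum_smul, hq.2, one_smul, H_self]
  have e' : ∑ g, negMulLog (∑ b, q b • p (g - b)) = H (tens p q) fun x => x.1 + x.2 := by
    simp only [H, law_add]
  rw [← e, ← e'] at h
  have := (sum_eq_sum_iff_of_le key).1 (le_antisymm (sum_le_sum key) h) g (mem_univ g)
  exact (strictConcaveOn_negMulLog.map_sum_eq_iff_of_nonneg (fun b _ => hq.1 b) hq.2
    fun b _ => hp.1 _).1 this.symm (mem_univ b) hb (mem_univ c) hc

lemma H_le_H_add (hp : p ∈ stdSimplex ℝ G) (hq : q ∈ stdSimplex ℝ G) :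
    H p (fun g => g) ≤ H (tens p q) (fun x => x.1 + x.2) := by
  have h1 := H_subadd (tens_mem hp hq) (fun x => x.1 + x.2) fun x => x.2
  have h2 := H_tens hp hq (fun g => g) fun g => g
  rw [H_tens_snd hp q fun g => g, H_congr _ (fun x => (x.1, x.2))] at h1
  · linarith
  · intro x x' _ _
    simp only [Prod.mk.injEq]
    exact and_congr_left fun e => by rw [e, add_left_inj]

lemma H_add_comm (p q : G → ℝ) :
    H (tens q p) (fun x => x.1 + x.2) = H (tens p q) (fun x => x.1 + x.2) := by
  rw [← H_tens_swap p q]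
  simp only [add_comm]

/-- The uniform distribution on a finite type. -/
noncomputable def unifW (α : Type*) [Fintype α] (_ : α) : ℝ := (Fintype.card α : ℝ)⁻¹

/-- If `rdist p q ≤ 0`, then `p` is uniformly distributed on a coset of a subspace. -/
lemma exists_submodule_of_rdist_nonpos [Module (ZMod 2) G] (hp : p ∈ stdSimplex ℝ G)
    (hq : q ∈ stdSimplex ℝ G) (h : rdist p q ≤ 0) :
    ∃ (𝒢 : Submodule (ZMod 2) G) (a : G), ∀ _ : Fintype 𝒢,
      p = law (unifW 𝒢) fun g => a + (g : G) := by
  have h1 := H_le_H_add hp hq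
  have h2 := H_le_H_add hq hp
  rw [H_add_comm] at h2
  rw [rdist] at h
  have inv1 : ∀ {b c : G}, q b ≠ 0 → q c ≠ 0 → ∀ g, p (g - b) = p (g - c) :=
    translate_eq_of_H_add_le hp hq (by linarith)
  have inv2 : ∀ {b c : G}, p b ≠ 0 → p c ≠ 0 → ∀ g, q (g - b) = q (g - c) :=
    translate_eq_of_H_add_le hq hp (by rw [H_add_comm]; linarith)
  have supp : ∀ {r : G → ℝ}, r ∈ stdSimplex ℝ G → ∃ a, r a ≠ 0 := fun {r} hr => by
    by_contra! h0
    simpa [h0] using hr.2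
  obtain ⟨a, ha⟩ := supp hp
  obtain ⟨b, hb⟩ := supp hq
  let K : AddSubgroup G :=
    { carrier := {h | ∀ g, p (g + h) = p g}
      zero_mem' := fun g => by simp
      add_mem' := fun {h k} hh hk g => by rw [← add_assoc, hk, hh]
      neg_mem' := fun {h} hh g => by rw [← hh (g + -h), neg_add_cancel_right] }
  have hK : ∀ {x}, p x ≠ 0 → x - a ∈ K := by
    intro x hx g
    have hbx : q (b + (x - a)) ≠ 0 := by
      have := inv2 ha hx (x + b)
      rw [add_sub_cancel_left] at this
      rwa [show b + (x - a) = x + b - a by abel, this]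
    have := inv1 hb hbx (g + b + (x - a))
    rwa [show g + b + (x - a) - b = g + (x - a) by abel,
      show g + b + (x - a) - (b + (x - a)) = g by abel] at this
  refine ⟨AddSubgroup.toZModSubmodule 2 K, a, fun _ => ?_⟩
  have hlaw : p = law (fun _ : AddSubgroup.toZModSubmodule 2 K => p a) fun g => a + (g : G) := by
    ext x
    by_cases hx : x - a ∈ K
    · rw [law_eq_single _ _ x ⟨x - a, hx⟩ fun g => by
        rw [← eq_sub_iff_add_eq', Subtype.ext_iff], ← hx a, add_sub_cancel]
    · rw [not_not.1 (mt hK hx), law, sum_eq_zero]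
      exact fun g _ => if_neg fun e => hx (by rw [← e, add_sub_cancel_left]; exact g.2)
  have hc : (Fintype.card (AddSubgroup.toZModSubmodule 2 K) : ℝ) * p a = 1 := by
    have := hp.2
    rw [hlaw, sum_law] at this
    simpa using this
  have hu : unifW (AddSubgroup.toZModSubmodule 2 K) = fun _ => p a := funext fun _ => by
    rw [unifW, inv_eq_of_mul_eq_one_right hc]
  rw [hu]
  exact hlaw

lemma rho_translate {Ω R : Type*} [Fintype Ω] [Fintype R] (w : Ω → ℝ) (A : Ω → G)
    (Z : Ω → R) (a : G) :
    rho y w (fun ω => a + A ω) Z = rho y w A Z := by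
  rw [rho, rho, H_congr (w := tens w y) (fun x => ((a + A x.1 + x.2.1, x.2.2), Z x.1))
      (fun x => ((A x.1 + x.2.1, x.2.2), Z x.1)) (by simp [add_assoc]),
    H_congr (w := w) (fun ω => (a + A ω, Z ω)) (fun ω => (A ω, Z ω)) (by simp)]

end Structure

section Main

variable {S T G : Type*} [Fintype S] [Fintype T] [AddCommGroup G] [Fintype G]
  {y : G × T → ℝ}

lemma continuous_H {α Ω R : Type*} [TopologicalSpace α] [Fintype Ω] [Fintype R] {f : α → Ω → ℝ}
    (hf : Continuous f) (X : Ω → R) : Continuous fun a => H (f a) X := by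
  classical
  refine continuous_finsetSum _ fun s _ => continuous_negMulLog.comp ?_
  refine continuous_finsetSum _ fun ω _ => ?_
  split_ifs
  · exact (continuous_apply ω).comp hf
  · exact continuous_const

lemma continuous_tens {α Ω Ω' : Type*} [TopologicalSpace α] {f : α → Ω → ℝ} {g : α → Ω' → ℝ}
    (hf : Continuous f) (hg : Continuous g) : Continuous fun a => tens (f a) (g a) :=
  continuous_pi fun x => ((continuous_apply x.1).comp hf).mul ((continuous_apply x.2).comp hg)

lemma continuous_rho₀ (y : G × T → ℝ) : Continuous (rho₀ y) := by
  unfold rho₀ rho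
  have h : Continuous fun p : G → ℝ => tens p y := continuous_tens continuous_id continuous_const
  exact (((continuous_H h _).sub (continuous_H continuous_id _)).sub continuous_const).sub
    (((continuous_H continuous_id _).sub (continuous_H continuous_id _)).div_const 2)
    |>.sub continuous_const

lemma continuous_rdist : Continuous fun x : (G → ℝ) × (G → ℝ) => rdist x.1 x.2 := by
  unfold rdist
  exact (continuous_H (continuous_tens continuous_fst continuous_snd) _).sub
    (((continuous_H continuous_fst _).add (continuous_H continuous_snd _)).div_const 2)

lemma exists_minimizer (y : G × T → ℝ) (η : ℝ) :
    ∃ p ∈ stdSimplex ℝ G, ∃ q ∈ stdSimplex ℝ G, ∀ p' ∈ stdSimplex ℝ G, ∀ q' ∈ stdSimplex ℝ G,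
      rdist p q + η * (rho₀ y p + rho₀ y q) ≤ rdist p' q' + η * (rho₀ y p' + rho₀ y q') := by
  classical
  have hcont : Continuous fun x : (G → ℝ) × (G → ℝ) =>
      rdist x.1 x.2 + η * (rho₀ y x.1 + rho₀ y x.2) :=
    continuous_rdist.add (continuous_const.mul
      (((continuous_rho₀ y).comp continuous_fst).add ((continuous_rho₀ y).comp continuous_snd)))
  have hne : (stdSimplex ℝ G ×ˢ stdSimplex ℝ G).Nonempty :=
    ⟨(Pi.single 0 1, Pi.single 0 1), single_mem_stdSimplex ℝ 0, single_mem_stdSimplex ℝ 0⟩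
  obtain ⟨⟨p, q⟩, hpq, h⟩ := ((isCompact_stdSimplex ℝ G).prod
    (isCompact_stdSimplex ℝ G)).exists_isMinOn hne hcont.continuousOn
  exact ⟨p, hpq.1, q, hpq.2, fun p' hp' q' hq' => isMinOn_iff.1 h (p', q') ⟨hp', hq'⟩⟩

/-- A triangle inequality. -/
lemma rho_self_le (h2 : ∀ g : G, g + g = 0) {w : G × S → ℝ} (hw : w ∈ stdSimplex ℝ (G × S))
    (hy : y ∈ stdSimplex ℝ (G × T)) :
    rho y y (fun v => v.1) (fun v => v.2) ≤ 2 * rho y w (fun v => v.1) (fun v => v.2) := by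
  have hyy := tens_mem hy hy
  have hW := tens_mem hw hyy
  set W := tens w (tens y y) with hWdef
  have s1 := H_submod hW (fun x => x.2.1.1 + x.1.1) (fun x => x.2.1.1)
    fun x => (((x.2.1.1 + x.2.2.1, x.2.2.2), x.2.1.2), x.1.2)
  have s2 := H_submod hW (fun x => (x.1.1 + x.2.1.1, x.2.1.2)) (fun x => (x.1.1 + x.2.2.1, x.2.2.2))
    fun x => x.1.2
  have e1 : H W (fun x => (x.2.1.1 + x.1.1, x.2.1.1,
      (((x.2.1.1 + x.2.2.1, x.2.2.2), x.2.1.2), x.1.2)))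
      = H w (fun v => v) + (H y (fun v => v) + H y (fun v => v)) := by
    rw [← H_tens hy hy, ← H_tens hw hyy]
    refine H_congr _ _ fun x x' _ _ => ?_
    simp only [Prod.ext_iff]
    constructor
    · rintro ⟨a, b, ⟨⟨c, d⟩, e⟩, f⟩
      rw [b, add_right_inj] at a c
      exact ⟨⟨a, f⟩, ⟨b, e⟩, c, d⟩
    · rintro ⟨⟨a, f⟩, ⟨b, e⟩, c, d⟩
      simp [a, b, c, d, e, f]
  have e2 : H W (fun x => (((x.2.1.1 + x.2.2.1, x.2.2.2), x.2.1.2), x.1.2))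
      = H w (fun v => v.2) + H (tens y y) (fun x => ((x.1.1 + x.2.1, x.2.2), x.1.2)) := by
    rw [← H_tens hw hyy]
    exact H_congr _ _ fun x x' _ _ => by simp only [Prod.mk.injEq, and_comm]
  have e3 : H W (fun x => (x.2.1.1, (((x.2.1.1 + x.2.2.1, x.2.2.2), x.2.1.2), x.1.2)))
      = H w (fun v => v.2) + (H y (fun v => v) + H y (fun v => v)) := by
    rw [← H_tens hy hy, ← H_tens hw hyy]
    refine H_congr _ _ fun x x' _ _ => ?_
    simp only [Prod.ext_iff]
    constructor
    · rintro ⟨b, ⟨⟨c, d⟩, e⟩, f⟩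
      rw [b, add_right_inj] at c
      exact ⟨f, ⟨b, e⟩, c, d⟩
    · rintro ⟨f, ⟨b, e⟩, c, d⟩
      simp [b, c, d, e, f]
  have e4 : H W (fun x => (x.2.1.1 + x.1.1, (((x.2.1.1 + x.2.2.1, x.2.2.2), x.2.1.2), x.1.2)))
      = H W (fun x => ((x.1.1 + x.2.1.1, x.2.1.2), (x.1.1 + x.2.2.1, x.2.2.2), x.1.2)) := by
    have key : ∀ a b c : G, b + c = (b + a) + (a + c) := fun a b c => by
      rw [← add_zero (b + c), ← h2 a]; abel
    refine H_congr _ _ fun x x' _ _ => ?_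
    simp only [Prod.mk.injEq]
    rw [key x.1.1 x.2.1.1 x.2.2.1, key x'.1.1 x'.2.1.1 x'.2.2.1, add_comm x.1.1 x.2.1.1, add_comm x'.1.1 x'.2.1.1]
    constructor
    · rintro ⟨b, ⟨⟨c, d⟩, e⟩, f⟩
      rw [b, add_right_inj] at c
      exact ⟨⟨b, e⟩, ⟨c, d⟩, f⟩
    · rintro ⟨⟨b, e⟩, ⟨c, d⟩, f⟩
      simp [b, c, d, e, f]
  have e5 : H W (fun x => x.1.2) = H w (fun v => v.2) := H_tens_fst w hyy fun v => v.2
  have e6 : H W (fun x => ((x.1.1 + x.2.1.1, x.2.1.2), x.1.2))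
      = H (tens w y) (fun x => ((x.1.1 + x.2.1, x.2.2), x.1.2)) := by
    have : law W (fun x => (x.1, x.2.1)) = tens w y := by
      rw [hWdef, law_tens_map w (tens y y) (fun v => v) (fun v => v.1),
        law_tens_fst y hy fun v => v, law_id, law_id]
    rw [← this, H_law]
  have e7 : H W (fun x => ((x.1.1 + x.2.2.1, x.2.2.2), x.1.2))
      = H (tens w y) (fun x => ((x.1.1 + x.2.1, x.2.2), x.1.2)) := by
    have : law W (fun x => (x.1, x.2.2)) = tens w y := by
      rw [hWdef, law_tens_map w (tens y y) (fun v => v) (fun v => v.2),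
        law_tens_snd hy y fun v => v, law_id, law_id]
    rw [← this, H_law]
  rw [e1, e2, e3, e4] at s1
  rw [e5, e6, e7] at s2
  simp only [rho]
  linarith

lemma exists_submodule_rho_le [Module (ZMod 2) G] {w : G × S → ℝ}
    (hw : w ∈ stdSimplex ℝ (G × S)) (hy : y ∈ stdSimplex ℝ (G × T)) :
    ∃ 𝒢 : Submodule (ZMod 2) G, ∀ _ : Fintype 𝒢,
      rho y (unifW 𝒢) (fun g => (g : G)) (fun _ => ())
        ≤ 7 * rho y w (fun v => v.1) (fun v => v.2) := by
  have h2 : ∀ g : G, g + g = 0 := fun g => by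
    rw [← two_smul (ZMod 2) g, show (2 : ZMod 2) = 0 from rfl, zero_smul]
  obtain ⟨p, hp, q, hq, hmin⟩ := exists_minimizer y (1 / 11)
  have h0 := rdist_nonpos_of_minimizer h2 hy hp hq hmin
  have hle : rho₀ y p + rho₀ y q ≤ 14 * rho y w (fun v => v.1) (fun v => v.2) := by
    have hW := tens_mem hw hy
    have hci := (condIndep_tens w y (fun v => v.2) (fun v => v.2)).comp (fun v => v.1) fun v => v.1
    have main := le_of_condIndep hW hy hmin hci
    have lX : law (tens w y) (fun x => x.1) = w := by
      rw [law_tens_fst w hy fun v => v, law_id]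
    have lY : law (tens w y) (fun x => x.2) = y := by
      rw [law_tens_snd hw y fun v => v, law_id]
    have hX : H (tens w y) (fun x => (x.1.1, x.1.2, x.2.2))
        = H w (fun v => v) + H y (fun v => v.2) := by
      rw [← H_tens hw hy]
      exact H_congr _ _ fun x x' _ _ => by simp only [Prod.ext_iff, and_assoc]
    have hY : H (tens w y) (fun x => (x.2.1, x.1.2, x.2.2))
        = H w (fun v => v.2) + H y (fun v => v) := by
      rw [← H_tens hw hy]
      exact H_congr _ _ fun x x' _ _ => by simp only [Prod.ext_iff, and_left_comm]
    have hZ : H (tens w y) (fun x => (x.1.2, x.2.2)) = H w (fun v => v.2) + H y (fun v => v.2) :=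
      H_tens hw hy _ _
    have rX := rho_cond_le hW hy (fun x => x.1.1) (fun x => x.2.2) fun x => x.1.2
    rw [rho_congr (fun x : (G × S) × G × T => x.1.1) (fun x => (x.2.2, x.1.2))
        (fun x => (x.1.2, x.2.2)) (by simp [and_comm]),
      ← rho_law y (tens w y) (fun x => x.1) (fun v => v.1) (fun v => v.2), lX,
      H_tens_fst w hy fun v => (v.1, v.2), H_tens_fst w hy fun v => v.2,
      H_congr (fun x : (G × S) × G × T => (x.2.2, x.1.2)) (fun x => (x.1.2, x.2.2))
        (by simp [and_comm]), hZ,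
      H_congr (fun x : (G × S) × G × T => (x.1.1, x.2.2, x.1.2)) (fun x => (x.1.1, x.1.2, x.2.2))
        (by simp [and_comm]), hX] at rX
    have rY := rho_cond_le hW hy (fun x => x.2.1) (fun x => x.1.2) fun x => x.2.2
    rw [← rho_law y (tens w y) (fun x => x.2) (fun v => v.1) (fun v => v.2), lY,
      H_tens_snd hw y fun v => (v.1, v.2), H_tens_snd hw y fun v => v.2, hY, hZ] at rY
    have htri := rho_self_le h2 hw hy
    rw [hX, hY, H_congr (fun x : (G × S) × G × T => (x.1.1 + x.2.1, x.1.2, x.2.2))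
      (fun x => ((x.1.1 + x.2.1, x.2.2), x.1.2))
      fun x x' _ _ => by simp only [Prod.mk.injEq, and_assoc, and_comm (a := x.1.2 = x'.1.2)]] at main
    have hd : rho y w (fun v => v.1) (fun v => v.2)
        = H (tens w y) (fun x => ((x.1.1 + x.2.1, x.2.2), x.1.2))
          - (H w (fun v => v) + H y (fun v => v.2) + (H w (fun v => v.2) + H y (fun v => v))) / 2 := by
      rw [rho]; ring
    have hpos : 0 ≤ rdist p q := by
      have := H_le_H_add hp hq
      have := H_le_H_add hq hp
      rw [H_add_comm] at this
      rw [rdist]; linarith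
    linarith
  have final : ∀ {r s : G → ℝ}, r ∈ stdSimplex ℝ G → s ∈ stdSimplex ℝ G → rdist r s ≤ 0 →
      rho₀ y r ≤ 7 * rho y w (fun v => v.1) (fun v => v.2) →
      ∃ 𝒢 : Submodule (ZMod 2) G, ∀ _ : Fintype 𝒢,
        rho y (unifW 𝒢) (fun g => (g : G)) (fun _ => ())
          ≤ 7 * rho y w (fun v => v.1) (fun v => v.2) := by
    intro r s hr hs hrs hle
    obtain ⟨𝒢, a, h⟩ := exists_submodule_of_rdist_nonpos hr hs hrs
    refine ⟨𝒢, fun _ => ?_⟩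
    rwa [h ‹_›, rho₀_law _ (fun _ => ()) (by simp), rho_translate] at hle
  rcases le_total (rho₀ y p) (rho₀ y q) with hpq | hpq
  · exact final hp hq h0 (by linarith)
  · exact final hq hp (by rwa [rdist, H_add_comm, add_comm (H q _), ← rdist]) (by linarith)

end Main

section Measure

variable {Ω Ω₁ Ω₂ R S T G : Type*} [MeasurableSpace Ω] [MeasurableSpace Ω₁] [MeasurableSpace Ω₂]
  [Fintype R] [Fintype S] [Fintype T]

/-- The distribution of a random variable. -/
noncomputable def wt (μ : Measure Ω) (V : Ω → R) (r : R) : ℝ := μ.real (V ⁻¹' {r})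

lemma measureReal_comp_preimage (μ : Measure Ω) [IsFiniteMeasure μ] {V : Ω → R}
    (hV : ∀ r, MeasurableSet (V ⁻¹' {r})) (F : R → S) (s : S) :
    μ.real ((fun ω => F (V ω)) ⁻¹' {s}) = law (wt μ V) F s := by
  classical
  have : (fun ω => F (V ω)) ⁻¹' {s} = ⋃ r ∈ univ.filter (fun r => F r = s), V ⁻¹' {r} := by
    ext ω; simp
  rw [this, measureReal_biUnion_finset _ fun r _ => hV r, sum_filter]
  · simp only [law, wt]
  · intro a _ b _ hab
    exact Disjoint.preimage V (by simpa using hab)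

lemma ent_eq_H (μ : Measure Ω) [IsFiniteMeasure μ] {V : Ω → R}
    (hV : ∀ r, MeasurableSet (V ⁻¹' {r})) (F : R → S) :
    ent μ (fun ω => F (V ω)) = H (wt μ V) F / log 2 := by
  rw [ent, tsum_fintype, H, sum_div, ← sum_neg_distrib]
  refine sum_congr rfl fun s _ => ?_
  rw [← measureReal_comp_preimage μ hV, negMulLog, logb, measureReal_def]
  ring

lemma wt_mem (μ : Measure Ω) [IsProbabilityMeasure μ] {V : Ω → R}
    (hV : ∀ r, MeasurableSet (V ⁻¹' {r})) : wt μ V ∈ stdSimplex ℝ R := by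
  refine ⟨fun r => measureReal_nonneg, ?_⟩
  have := measureReal_comp_preimage μ hV (fun _ => ()) ()
  simpa [law] using this.symm

lemma wt_prod (μ : Measure Ω₁) (ν : Measure Ω₂) [SFinite ν] (V : Ω₁ → R) (U : Ω₂ → S) :
    wt (μ.prod ν) (fun x => (V x.1, U x.2)) = tens (wt μ V) (wt ν U) := by
  ext ⟨r, s⟩
  have : (fun x : Ω₁ × Ω₂ => (V x.1, U x.2)) ⁻¹' {(r, s)} = (V ⁻¹' {r}) ×ˢ (U ⁻¹' {s}) := by
    ext x; simp
  rw [wt, this, measureReal_prod_prod, tens, wt, wt]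

lemma measurableSet_prod_preimage {V : Ω₁ → R} {U : Ω₂ → S}
    (hV : ∀ r, MeasurableSet (V ⁻¹' {r})) (hU : ∀ s, MeasurableSet (U ⁻¹' {s})) (t : R × S) :
    MeasurableSet ((fun x : Ω₁ × Ω₂ => (V x.1, U x.2)) ⁻¹' {t}) := by
  have : (fun x : Ω₁ × Ω₂ => (V x.1, U x.2)) ⁻¹' {t} = (V ⁻¹' {t.1}) ×ˢ (U ⁻¹' {t.2}) := by
    ext x; simp [Prod.ext_iff]
  rw [this]
  exact (hV _).prod (hU _)

variable [AddCommGroup G] [Fintype G]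

lemma condRdist_eq_rho (μ : Measure Ω₁) (ν : Measure Ω₂) [IsProbabilityMeasure μ]
    [IsProbabilityMeasure ν] {V : Ω₁ → R} (hV : ∀ r, MeasurableSet (V ⁻¹' {r})) (A : R → G)
    (Z : R → S) {Y : Ω₂ → G} {B : Ω₂ → T}
    (hY : ∀ t, MeasurableSet ((fun ω => (Y ω, B ω)) ⁻¹' {t})) :
    condRdist μ ν (fun ω => A (V ω)) (fun ω => Z (V ω)) Y B
      = rho (wt ν fun ω => (Y ω, B ω)) (wt μ V) A Z / log 2 := by
  have hW := measurableSet_prod_preimage hV hY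
  simp only [condRdist, condEnt]
  rw [ent_eq_H _ hW fun x => (A x.1 + x.2.1, Z x.1, x.2.2), ent_eq_H _ hW fun x => (Z x.1, x.2.2),
    ent_eq_H μ hV fun r => (A r, Z r), ent_eq_H μ hV Z, ent_eq_H ν hY fun v => v,
    ent_eq_H ν hY fun v => v.2, wt_prod μ ν V fun ω => (Y ω, B ω), H_tens (wt_mem μ hV) (wt_mem ν hY) Z fun v => v.2,
    H_congr (fun x : R × G × T => (A x.1 + x.2.1, Z x.1, x.2.2))
      (fun x => ((A x.1 + x.2.1, x.2.2), Z x.1))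
      fun x x' _ _ => by simp only [Prod.mk.injEq, and_assoc, and_comm (a := Z x.1 = Z x'.1)], rho]
  ring

lemma condRdist_comm (μ : Measure Ω₁) (ν : Measure Ω₂) [IsProbabilityMeasure μ]
    [IsProbabilityMeasure ν] {X : Ω₁ → G} {A : Ω₁ → S} {Y : Ω₂ → G} {B : Ω₂ → T}
    (hX : ∀ t, MeasurableSet ((fun ω => (X ω, A ω)) ⁻¹' {t}))
    (hY : ∀ t, MeasurableSet ((fun ω => (Y ω, B ω)) ⁻¹' {t})) :
    condRdist ν μ Y B X A = condRdist μ ν X A Y B := by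
  have hW := measurableSet_prod_preimage hX hY
  have hW' := measurableSet_prod_preimage hY hX
  simp only [condRdist, condEnt]
  rw [ent_eq_H _ hW fun x => (x.1.1 + x.2.1, x.1.2, x.2.2), ent_eq_H _ hW fun x => (x.1.2, x.2.2),
    ent_eq_H _ hW' fun x => (x.1.1 + x.2.1, x.1.2, x.2.2), ent_eq_H _ hW' fun x => (x.1.2, x.2.2),
    wt_prod μ ν (fun ω => (X ω, A ω)) fun ω => (Y ω, B ω),
    wt_prod ν μ (fun ω => (Y ω, B ω)) fun ω => (X ω, A ω), ← H_tens_swap (wt ν _), ← H_tens_swap (wt ν _),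
    H_congr (fun x : (G × S) × G × T => ((x.2, x.1).1.2, (x.2, x.1).2.2))
      (fun x => (x.1.2, x.2.2)) (by simp [and_comm]),
    H_congr (fun x : (G × S) × G × T =>
        ((x.2, x.1).1.1 + (x.2, x.1).2.1, (x.2, x.1).1.2, (x.2, x.1).2.2))
      (fun x => (x.1.1 + x.2.1, x.1.2, x.2.2))
      fun x x' _ _ => by
        simp only [Prod.mk.injEq, add_comm x.1.1, add_comm x'.1.1, and_comm (a := x.1.2 = x'.1.2)]]
  ring

lemma isProbabilityMeasure_unifM (α : Type*) [MeasurableSpace α] [MeasurableSingletonClass α]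
    [Finite α] [Nonempty α] : IsProbabilityMeasure (unifM α) := by
  refine ⟨?_⟩
  rw [unifM, Measure.smul_apply, smul_eq_mul, ENNReal.inv_mul_cancel]
  · simp
  · exact (measure_lt_top _ _).ne

lemma wt_unifM (α : Type*) [MeasurableSpace α] [MeasurableSingletonClass α] [Fintype α] :
    wt (unifM α) (fun a => a) = unifW α := by
  ext a
  simp [wt, unifM, unifW, measureReal_def]

end Measure

end WeightedEntropy

/-- conditional entropic Freiman–Ruzsa theorem: for `F₂^k`-valued random
variables `X, Y` and finitely-valued `A, B`, there is a subspace `𝒢 ⊆ F₂^k` with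
`d(Y|B, U_𝒢) ≤ 7 · d(X|A, Y|B)`, where `U_𝒢` is uniform on `𝒢` (with trivial conditioning). -/
theorem stmt3 {Ω₁ Ω₂ S T : Type*} [MeasurableSpace Ω₁] [MeasurableSpace Ω₂]
    [Finite S] [MeasurableSpace S] [MeasurableSingletonClass S]
    [Finite T] [MeasurableSpace T] [MeasurableSingletonClass T]
    (k : ℕ) (μ₁ : Measure Ω₁) (μ₂ : Measure Ω₂)
    [IsProbabilityMeasure μ₁] [IsProbabilityMeasure μ₂]
    (X : Ω₁ → (Fin k → ZMod 2)) (A : Ω₁ → S) (Y : Ω₂ → (Fin k → ZMod 2)) (B : Ω₂ → T)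
    (hX : Measurable X) (hA : Measurable A) (hY : Measurable Y) (hB : Measurable B) :
    ∃ 𝒢 : Submodule (ZMod 2) (Fin k → ZMod 2),
      condRdist μ₂ (unifM ↥𝒢) Y B (fun g => (g : Fin k → ZMod 2)) (fun _ => ())
        ≤ 7 * condRdist μ₁ μ₂ X A Y B := by
  have := Fintype.ofFinite S
  have := Fintype.ofFinite T
  have hXA : ∀ t, MeasurableSet ((fun ω => (X ω, A ω)) ⁻¹' {t}) := fun t =>
    (hX.prodMk hA) (measurableSet_singleton t)
  have hYB : ∀ t, MeasurableSet ((fun ω => (Y ω, B ω)) ⁻¹' {t}) := fun t =>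
    (hY.prodMk hB) (measurableSet_singleton t)
  obtain ⟨𝒢, h⟩ := WeightedEntropy.exists_submodule_rho_le (WeightedEntropy.wt_mem μ₁ hXA)
    (WeightedEntropy.wt_mem μ₂ hYB)
  refine ⟨𝒢, ?_⟩
  have := Fintype.ofFinite 𝒢
  have := WeightedEntropy.isProbabilityMeasure_unifM 𝒢
  have hU : ∀ g : 𝒢, MeasurableSet ((fun g => g) ⁻¹' {g}) := fun g => measurableSet_singleton g
  have hU' : ∀ t : (Fin k → ZMod 2) × Unit,
      MeasurableSet ((fun g : 𝒢 => ((g : Fin k → ZMod 2), ())) ⁻¹' {t}) := fun t =>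
    (Set.toFinite _).measurableSet
  rw [WeightedEntropy.condRdist_comm (unifM 𝒢) μ₂ hU' hYB,
    WeightedEntropy.condRdist_eq_rho (unifM 𝒢) μ₂ hU (fun g => (g : Fin k → ZMod 2))
      (fun _ => ()) hYB,
    WeightedEntropy.condRdist_eq_rho μ₁ μ₂ hXA (fun v => v.1) (fun v => v.2) hYB,
    WeightedEntropy.wt_unifM, ← mul_div_assoc]
  exact div_le_div_of_nonneg_right (h _) (Real.log_nonneg one_le_two)
end

section
/- Let 𝒢 ⊆ F_{m,r} be an F₂-linear subspace such that π(𝒢) = 𝒢 for every π ∈ Sym(m,r). Then 𝒢 = {0} or 𝒢 = F_{m,r}. -/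
/-- Coefficient space of the degree-`r` part: `F_{m,r} ≅ F₂^{binom(m,r)}`,
with coordinates indexed by the `r`-element subsets of `[m]` (coefficients of the
squarefree monomials `x_I`, `|I| = r`). -/
abbrev Coef (m r : ℕ) := {I : Finset (Fin m) // I.card = r} → ZMod 2

/-- The Boolean function `x ↦ ∑_I c_I ∏_{i ∈ I} x_i` determined by a full coefficient vector. -/
def evalC (m : ℕ) (c : Finset (Fin m) → ZMod 2) : (Fin m → ZMod 2) → ZMod 2 :=
  fun x => ∑ I : Finset (Fin m), c I * ∏ i ∈ I, x i

/-- The coefficient (in the multilinear expansion) of the monomial `x_I` of a Boolean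
function `f`, via Möbius inversion over `F₂`: `c_I = ∑_{S ⊆ I} f(1_S)`. -/
def coefC (m : ℕ) (f : (Fin m → ZMod 2) → ZMod 2) : Finset (Fin m) → ZMod 2 :=
  fun I => ∑ S ∈ I.powerset, f (fun i => if i ∈ S then 1 else 0)

/-- Extension of a degree-`r` coefficient vector to a full coefficient vector
(supported on the `r`-element subsets). -/
def degPart (m r : ℕ) (c : Coef m r) : Finset (Fin m) → ZMod 2 :=
  fun I => if h : I.card = r then c ⟨I, h⟩ else 0

/-- The map on degree-`r` coefficient vectors induced by the substitution `x ↦ Ax + b`: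
substitute in the corresponding polynomial and keep only the degree-`r` coefficients. -/
def symMap (m r : ℕ) (A : Matrix (Fin m) (Fin m) (ZMod 2)) (b : Fin m → ZMod 2)
    (c : Coef m r) : Coef m r :=
  fun J => coefC m (fun x => evalC m (degPart m r c) (A.mulVec x + b)) J.val

/-- `symMap` as an `F₂`-linear map. -/
noncomputable def symLin (m r : ℕ) (A : Matrix (Fin m) (Fin m) (ZMod 2)) (b : Fin m → ZMod 2) :
    Coef m r →ₗ[ZMod 2] Coef m r :=
  AddMonoidHom.toZModLinearMap 2 (AddMonoidHom.mk' (symMap m r A b) (by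
    intro c c'
    funext J
    have h1 : degPart m r (c + c') = degPart m r c + degPart m r c' := by
      funext I; by_cases h : I.card = r <;> simp [degPart, h]
    have h2 : ∀ u v : Finset (Fin m) → ZMod 2, evalC m (u + v) = evalC m u + evalC m v := by
      intro u v; funext x; simp [evalC, add_mul, Finset.sum_add_distrib]
    have h4 : ∀ f g : (Fin m → ZMod 2) → ZMod 2, coefC m (f + g) = coefC m f + coefC m g := by
      intro f g; funext I; simp [coefC, Finset.sum_add_distrib]
    show symMap m r A b (c + c') J = symMap m r A b c J + symMap m r A b c' J
    simp only [symMap, h1, h2]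
    have : (fun x => (evalC m (degPart m r c) + evalC m (degPart m r c')) (A.mulVec x + b))
        = (fun x => evalC m (degPart m r c) (A.mulVec x + b))
          + (fun x => evalC m (degPart m r c') (A.mulVec x + b)) := rfl
    rw [this, h4]
    rfl))

/-- The `r`-subset obtained from `J` by exchanging the roles of the indices `i` and `j`. -/
def swapIdx {m r : ℕ} (i j : Fin m) (J : {I : Finset (Fin m) // I.card = r}) :
    {I : Finset (Fin m) // I.card = r} :=
  ⟨J.1.map (Equiv.swap i j).toEmbedding, by rw [Finset.card_map, J.2]⟩

theorem swapIdx_swapIdx {m r : ℕ} (i j : Fin m) (J : {I : Finset (Fin m) // I.card = r}) :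
    swapIdx i j (swapIdx i j J) = J := by
  apply Subtype.ext
  ext k
  simp [swapIdx, Finset.mem_map_equiv]

theorem mem_swapIdx {m r : ℕ} (i j k : Fin m) (J : {I : Finset (Fin m) // I.card = r}) :
    k ∈ (swapIdx i j J).1 ↔ Equiv.swap i j k ∈ J.1 := by
  simp [swapIdx, Finset.mem_map_equiv]

/-- Möbius inversion over `F₂` on the interval `[K, J]`. -/
theorem sum_powerset_subset_indicator {α : Type*} [DecidableEq α] (K J : Finset α) :
    ∑ S ∈ J.powerset, (if K ⊆ S then (1 : ZMod 2) else 0) = if K = J then 1 else 0 := by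
  rw [Finset.sum_boole]
  have hIcc : {S ∈ J.powerset | K ⊆ S} = Finset.Icc K J := by
    ext S
    simp [and_comm]
  rw [hIcc]
  by_cases h : K ⊆ J
  · rw [Finset.card_Icc_finset h]
    by_cases hKJ : K = J
    · simp [hKJ]
    · have hlt := Finset.card_lt_card (Finset.ssubset_iff_subset_ne.2 ⟨h, hKJ⟩)
      have h2 : (2 : ZMod 2) = 0 := rfl
      rw [if_neg hKJ, Nat.cast_pow, Nat.cast_ofNat, h2, zero_pow (by omega)]
  · rw [Finset.Icc_eq_empty h, if_neg (fun e => h e.subset)]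
    simp

theorem prod_transvection_mulVec {m : ℕ} {i j : Fin m} (I S : Finset (Fin m)) :
    ∏ k ∈ I, ((Matrix.transvection i j (1 : ZMod 2)).mulVec
        (fun l => if l ∈ S then 1 else 0) + 0) k =
      (if I ⊆ S then 1 else 0) +
        if i ∈ I then (if insert j (I.erase i) ⊆ S then 1 else 0) else 0 := by
  have hent : ∀ k, ((Matrix.transvection i j (1 : ZMod 2)).mulVec
      (fun l => if l ∈ S then 1 else 0) + 0) k =
      (if k ∈ S then 1 else 0) + if k = i then (if j ∈ S then 1 else 0) else 0 := by
    intro k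
    simp [Matrix.transvection, Matrix.add_mulVec, Matrix.single_mulVec, Function.update_apply]
  have hprod : ∀ T : Finset (Fin m), ∏ k ∈ T, (if k ∈ S then (1 : ZMod 2) else 0) =
      if T ⊆ S then 1 else 0 := by
    intro T
    rw [Finset.prod_ite_zero]
    simp [Finset.subset_iff]
  by_cases hi : i ∈ I
  · have herase : ∏ k ∈ I.erase i, ((if k ∈ S then (1 : ZMod 2) else 0) +
        if k = i then (if j ∈ S then 1 else 0) else 0) = if I.erase i ⊆ S then 1 else 0 := by
      rw [← hprod]
      refine Finset.prod_congr rfl fun k hk => ?_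
      simp [Finset.ne_of_mem_erase hk]
    have hI : I ⊆ S ↔ i ∈ S ∧ I.erase i ⊆ S := by
      rw [← Finset.insert_subset_iff, Finset.insert_erase hi]
    simp only [hent]
    rw [← Finset.mul_prod_erase _ _ hi, herase, if_pos rfl, if_pos hi]
    simp only [hI, Finset.insert_subset_iff]
    by_cases h1 : i ∈ S <;> by_cases h2 : j ∈ S <;> by_cases h3 : I.erase i ⊆ S <;>
      simp [h1, h2, h3]
  · simp only [hent]
    rw [if_neg hi, add_zero, ← hprod]
    refine Finset.prod_congr rfl fun k hk => ?_
    have hki : k ≠ i := fun e => hi (e ▸ hk)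
    rw [if_neg hki, add_zero]

theorem insert_erase_eq_iff {m r : ℕ} {i j : Fin m} (hij : i ≠ j)
    (I J : {I : Finset (Fin m) // I.card = r}) :
    (i ∈ I.1 ∧ insert j (I.1.erase i) = J.1) ↔ (j ∈ J.1 ∧ i ∉ J.1) ∧ I = swapIdx i j J := by
  constructor
  · rintro ⟨hi, hJ⟩
    have hj : j ∉ I.1 := by
      intro hj
      rw [Finset.insert_eq_of_mem (Finset.mem_erase.2 ⟨hij.symm, hj⟩)] at hJ
      have := Finset.card_erase_lt_of_mem hi
      rw [hJ, I.2, J.2] at this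
      exact this.false
    refine ⟨⟨by simp [← hJ], by simp [← hJ, hij]⟩, Subtype.ext (Finset.ext fun k => ?_)⟩
    rw [mem_swapIdx, ← hJ, Equiv.swap_apply_def]
    split_ifs <;> grind
  · rintro ⟨⟨hj, hi⟩, rfl⟩
    refine ⟨by simpa [mem_swapIdx] using hj, Finset.ext fun k => ?_⟩
    rw [Finset.mem_insert, Finset.mem_erase, mem_swapIdx, Equiv.swap_apply_def]
    split_ifs <;> grind

/-- The substitution `x_i ↦ x_i + x_j` adds to the coefficient of `x_J` that of the monomial in
which `x_j` is replaced by `x_i`. -/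
theorem symLin_transvection_apply {m r : ℕ} {i j : Fin m} (hij : i ≠ j) (c : Coef m r)
    (J : {I : Finset (Fin m) // I.card = r}) :
    symLin m r (Matrix.transvection i j 1) 0 c J =
      c J + if j ∈ J.1 ∧ i ∉ J.1 then c (swapIdx i j J) else 0 := by
  have hdeg : ∀ g : Finset (Fin m) → ZMod 2, ∑ I, degPart m r c I * g I =
      ∑ I : {I : Finset (Fin m) // I.card = r}, c I * g I.1 := by
    intro g
    rw [← Finset.sum_filter_of_ne (p := fun I => I.card = r)
      (fun I _ hI => by_contra fun h => hI (by simp [degPart, h])),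
      Finset.sum_subtype _ (p := fun I => I.card = r) (by simp)]
    exact Finset.sum_congr rfl fun I _ => by simp [degPart, I.2]
  change ∑ S ∈ J.1.powerset, ∑ I, degPart m r c I * _ = _
  simp only [prod_transvection_mulVec]
  rw [Finset.sum_comm]
  simp only [← Finset.mul_sum]
  rw [hdeg]
  have hinner : ∀ I : {I : Finset (Fin m) // I.card = r},
      ∑ S ∈ J.1.powerset, ((if I.1 ⊆ S then (1 : ZMod 2) else 0) +
        if i ∈ I.1 then (if insert j (I.1.erase i) ⊆ S then 1 else 0) else 0) =
      (if I = J then 1 else 0) +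
        if I = swapIdx i j J then (if j ∈ J.1 ∧ i ∉ J.1 then 1 else 0) else 0 := by
    intro I
    rw [Finset.sum_add_distrib, sum_powerset_subset_indicator, Finset.sum_ite_irrel,
      sum_powerset_subset_indicator, Finset.sum_const_zero, ← ite_and, ← ite_and,
      if_congr (insert_erase_eq_iff hij I J) rfl rfl]
    simp only [Subtype.ext_iff, and_comm]
  simp only [hinner, mul_add, Finset.sum_add_distrib, mul_ite, mul_one, mul_zero,
    Finset.sum_ite_eq', Finset.mem_univ, if_true]

/-- The nilpotent part of the substitution `x_i ↦ x_i + x_j`. -/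
def transferCoef {m r : ℕ} (i j : Fin m) (c : Coef m r) : Coef m r :=
  fun J => if j ∈ J.1 ∧ i ∉ J.1 then c (swapIdx i j J) else 0

theorem transferCoef_mem {m r : ℕ} {𝒢 : Submodule (ZMod 2) (Coef m r)}
    (hinv : ∀ A : Matrix (Fin m) (Fin m) (ZMod 2), IsUnit A → ∀ b : Fin m → ZMod 2,
      Submodule.map (symLin m r A b) 𝒢 = 𝒢)
    {i j : Fin m} (hij : i ≠ j) {c : Coef m r} (hc : c ∈ 𝒢) : transferCoef i j c ∈ 𝒢 := by
  have hunit : IsUnit (Matrix.transvection i j (1 : ZMod 2)) := by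
    rw [Matrix.isUnit_iff_isUnit_det, Matrix.det_transvection_of_ne i j hij]
    exact isUnit_one
  have hmem : symLin m r (Matrix.transvection i j 1) 0 c ∈ 𝒢 := by
    rw [← hinv _ hunit 0]
    exact Submodule.mem_map_of_mem hc
  convert 𝒢.sub_mem hmem hc using 1
  funext J
  rw [Pi.sub_apply, symLin_transvection_apply hij, add_sub_cancel_left]
  rfl

/-- Two distinct sets of the same size can be separated by a pair of indices. -/
theorem exists_mem_notMem_of_ne {m r : ℕ} {I K : {I : Finset (Fin m) // I.card = r}}
    (h : I ≠ K) : ∃ i j, i ≠ j ∧ i ∈ I.1 ∧ i ∉ K.1 ∧ j ∈ K.1 ∧ j ∉ I.1 := by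
  have hIK : ¬ I.1 ⊆ K.1 := fun hs =>
    h (Subtype.ext (Finset.eq_of_subset_of_card_le hs (by rw [I.2, K.2])))
  have hKI : ¬ K.1 ⊆ I.1 := fun hs =>
    h (Subtype.ext (Finset.eq_of_subset_of_card_le hs (by rw [I.2, K.2])).symm)
  obtain ⟨i, hiI, hiK⟩ := Finset.not_subset.1 hIK
  obtain ⟨j, hjK, hjI⟩ := Finset.not_subset.1 hKI
  exact ⟨i, j, fun e => hiK (e ▸ hjK), hiI, hiK, hjK, hjI⟩

theorem transferCoef_single {m r : ℕ} {i j : Fin m} {I : {I : Finset (Fin m) // I.card = r}}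
    (hi : i ∈ I.1) (hj : j ∉ I.1) :
    transferCoef i j (Pi.single I 1 : Coef m r) = Pi.single (swapIdx i j I) 1 := by
  funext J
  by_cases hJ : J = swapIdx i j I
  · subst hJ
    simp [transferCoef, mem_swapIdx, swapIdx_swapIdx, hi, hj]
  · have hne : swapIdx i j J ≠ I := fun e => hJ (by rw [← e, swapIdx_swapIdx])
    simp [transferCoef, hJ, hne]

/-- A nonzero invariant subspace contains a monomial. -/
theorem exists_single_mem {m r : ℕ} {𝒢 : Submodule (ZMod 2) (Coef m r)}
    (hinv : ∀ A : Matrix (Fin m) (Fin m) (ZMod 2), IsUnit A → ∀ b : Fin m → ZMod 2,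
      Submodule.map (symLin m r A b) 𝒢 = 𝒢)
    {c : Coef m r} (hc : c ∈ 𝒢) (hc0 : c ≠ 0) : ∃ I, (Pi.single I 1 : Coef m r) ∈ 𝒢 := by
  induction hn : (Finset.univ.filter fun I => c I ≠ 0).card using Nat.strong_induction_on
    generalizing c with
  | _ n ih =>
    obtain ⟨I, hI⟩ := Function.ne_iff.1 hc0
    by_cases hK : ∃ K, K ≠ I ∧ c K ≠ 0
    · obtain ⟨K, hKI, hcK⟩ := hK
      obtain ⟨i, j, hij, hiI, hiK, hjK, hjI⟩ := exists_mem_notMem_of_ne hKI.symm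
      refine ih _ ?_ (transferCoef_mem hinv hij hc) ?_ rfl
      · rw [← hn, ← Finset.card_map ⟨swapIdx i j,
          Function.LeftInverse.injective (swapIdx_swapIdx i j)⟩]
        refine Finset.card_lt_card (Finset.ssubset_iff_of_subset ?_ |>.2 ⟨K, ?_, ?_⟩)
        · intro L hL
          obtain ⟨J, hJ, rfl⟩ := Finset.mem_map.1 hL
          simp only [transferCoef, Finset.mem_filter, Finset.mem_univ, true_and, ne_eq,
            ite_eq_right_iff, Classical.not_imp] at hJ
          simpa using hJ.2
        · simpa using hcK
        · intro hL
          obtain ⟨J, hJ, hJK⟩ := Finset.mem_map.1 hL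
          simp only [transferCoef, Finset.mem_filter, Finset.mem_univ, true_and, ne_eq,
            ite_eq_right_iff, Classical.not_imp] at hJ
          refine hiK ?_
          rw [← hJK]
          simpa [mem_swapIdx] using hJ.1.1
      · refine Function.ne_iff.2 ⟨swapIdx i j I, ?_⟩
        simpa [transferCoef, mem_swapIdx, swapIdx_swapIdx, hiI, hjI] using hI
    · push Not at hK
      refine ⟨I, ?_⟩
      convert hc using 1
      funext K
      by_cases hKI : K = I
      · subst hKI
        rw [Pi.single_eq_same]
        exact (Fin.eq_one_of_ne_zero (c K) hI).symm
      · rw [Pi.single_eq_of_ne hKI, hK K hKI]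

/-- An invariant subspace containing one monomial contains all of them. -/
theorem single_mem_of_single_mem {m r : ℕ} {𝒢 : Submodule (ZMod 2) (Coef m r)}
    (hinv : ∀ A : Matrix (Fin m) (Fin m) (ZMod 2), IsUnit A → ∀ b : Fin m → ZMod 2,
      Submodule.map (symLin m r A b) 𝒢 = 𝒢)
    (J : {I : Finset (Fin m) // I.card = r}) {I : {I : Finset (Fin m) // I.card = r}}
    (hI : (Pi.single I 1 : Coef m r) ∈ 𝒢) : (Pi.single J 1 : Coef m r) ∈ 𝒢 := by
  induction hn : (I.1 \ J.1).card using Nat.strong_induction_on generalizing I with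
  | _ n ih =>
    by_cases hIJ : I = J
    · exact hIJ ▸ hI
    · obtain ⟨i, j, hij, hiI, hiJ, hjJ, hjI⟩ := exists_mem_notMem_of_ne hIJ
      have hmem := transferCoef_mem hinv hij hI
      rw [transferCoef_single hiI hjI] at hmem
      refine ih _ ?_ hmem rfl
      rw [← hn]
      refine Finset.card_lt_card (Finset.ssubset_iff_of_subset ?_ |>.2 ⟨i, ?_, ?_⟩)
      · intro k hk
        rw [Finset.mem_sdiff, mem_swapIdx, Equiv.swap_apply_def] at hk
        rw [Finset.mem_sdiff]
        split_ifs at hk <;> grind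
      · simp [hiI, hiJ]
      · simp [mem_swapIdx, hjI]

/-- if a subspace `𝒢 ⊆ F_{m,r}` satisfies `π(𝒢) = 𝒢` for every
`π ∈ Sym(m,r)` (i.e. every automorphism induced by an invertible affine substitution
`x ↦ Ax + b`), then `𝒢 = {0}` or `𝒢 = F_{m,r}`. -/
theorem stmt5 (m r : ℕ) (𝒢 : Submodule (ZMod 2) (Coef m r))
    (hinv : ∀ A : Matrix (Fin m) (Fin m) (ZMod 2), IsUnit A → ∀ b : Fin m → ZMod 2,
      Submodule.map (symLin m r A b) 𝒢 = 𝒢) :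
    𝒢 = ⊥ ∨ 𝒢 = ⊤ := by
  refine or_iff_not_imp_left.2 fun hbot => ?_
  obtain ⟨c, hc, hc0⟩ := Submodule.exists_mem_ne_zero_of_ne_bot hbot
  obtain ⟨I, hI⟩ := exists_single_mem hinv hc hc0
  refine eq_top_iff.2 fun d _ => ?_
  rw [pi_eq_sum_univ' d]
  refine 𝒢.sum_mem fun J _ => 𝒢.smul_mem _ ?_
  convert single_mem_of_single_mem hinv J hI using 1
end

section
/- Let π be an automorphism of F₂^{binom(m,r)} induced by an invertible affine transformation x ↦ Ax+b of F₂^m (i.e., π is the action of the coefficient map P(x) ↦ P(Ax+b) restricted to degree-r monomial coefficients). Then for every F₂-linear subspace 𝒢 ⊆ F₂^{binom(m,r)}, d(U_𝒢; W_r|W_{>r}) = d(U_{π(𝒢)}; W_r|W_{>r}), where U_𝒢 is uniform on 𝒢 and independent of W. -/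
open MeasureTheory

/-- Index set: binary strings of length `m` (indexing both coordinates and monomials). -/
abbrev Idx (m : ℕ) := Fin m → ZMod 2

/-- Hamming weight of a binary string. -/
def wt {m : ℕ} (x : Idx m) : ℕ := (Finset.univ.filter (fun i => x i = 1)).card

/-- The 2×2 base matrix `[[1,0],[1,1]]` (rows/columns indexed by `F₂`):
entry `(a,b)` is `0` iff `a = 0` and `b = 1`. -/
def base : ZMod 2 → ZMod 2 → ZMod 2 := fun a b => if a = 0 ∧ b = 1 then 0 else 1

/-- The `m`-fold Kronecker power `G = [[1,0],[1,1]]^{⊗ m}`, as a matrix indexed by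
binary strings of length `m`. -/
def Gmat (m : ℕ) : Matrix (Idx m) (Idx m) (ZMod 2) := fun x y => ∏ i, base (x i) (y i)

/-- The Bernoulli(δ) measure on `F₂` (probability `δ` of `1`). -/
noncomputable def bern2 (δ : ℝ) : Measure (ZMod 2) :=
  ENNReal.ofReal δ • Measure.dirac 1 + ENNReal.ofReal (1 - δ) • Measure.dirac 0

/-- The law of the i.i.d. Bernoulli(δ) noise vector `Z = (Z_x)_{x ∈ F₂^m}`. -/
noncomputable def noise (m : ℕ) (δ : ℝ) : Measure (Idx m → ZMod 2) :=
  Measure.pi (fun _ => bern2 δ)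

/-- The transformed noise vector `W = G Z`. -/
def Wfun (m : ℕ) (z : Idx m → ZMod 2) : Idx m → ZMod 2 := (Gmat m).mulVec z

/-- `W_r`: the coordinates of `W` whose index has Hamming weight exactly `r`. -/
def Wr (m r : ℕ) (z : Idx m → ZMod 2) : {x : Idx m // wt x = r} → ZMod 2 :=
  fun x => Wfun m z x.val

/-- `W_{>r}`: the coordinates of `W` whose index has Hamming weight `> r`. -/
def Wgt (m r : ℕ) (z : Idx m → ZMod 2) : {x : Idx m // r < wt x} → ZMod 2 :=
  fun x => Wfun m z x.val

/-- `W_{≤r}`: the coordinates of `W` whose index has Hamming weight `≤ r`. -/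
def Wle (m r : ℕ) (z : Idx m → ZMod 2) : {x : Idx m // wt x ≤ r} → ZMod 2 :=
  fun x => Wfun m z x.val

/-- Degree-`r` coefficient vectors, indexed by the weight-`r` binary strings
(i.e. `F₂^{binom(m,r)}`). -/
abbrev Vr (m r : ℕ) := {x : Idx m // wt x = r} → ZMod 2

/-- The Boolean function `x ↦ ∑_s c_s ∏_{i : s_i = 1} x_i` determined by a full
coefficient vector `c` (monomials indexed by their support string `s`). -/
def evalI (m : ℕ) (c : Idx m → ZMod 2) : Idx m → ZMod 2 :=
  fun x => ∑ s : Idx m, c s * ∏ i, (if s i = 1 then x i else 1)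

/-- The coefficient of the monomial with support `s` in the multilinear expansion of a
Boolean function `f`, via Möbius inversion over `F₂`: `c_s = ∑_{t ≤ s} f(t)`. -/
def coefI (m : ℕ) (f : Idx m → ZMod 2) : Idx m → ZMod 2 :=
  fun s => ∑ t : Idx m, if (∀ i, t i = 1 → s i = 1) then f t else 0

/-- Extension of a degree-`r` coefficient vector to a full coefficient vector
(supported on the weight-`r` strings). -/
def degI (m r : ℕ) (c : Vr m r) : Idx m → ZMod 2 :=
  fun s => if h : wt s = r then c ⟨s, h⟩ else 0

/-- The map on degree-`r` coefficient vectors induced by the substitution `x ↦ Ax + b`: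
substitute in the corresponding polynomial and keep only the degree-`r` coefficients. -/
def symMapI (m r : ℕ) (A : Matrix (Fin m) (Fin m) (ZMod 2)) (b : Fin m → ZMod 2)
    (c : Vr m r) : Vr m r :=
  fun J => coefI m (fun x => evalI m (degI m r c) (A.mulVec x + b)) J.val

/-- `symMapI` as an `F₂`-linear map: the automorphism `π` of `F₂^{binom(m,r)}` induced by
the invertible affine transformation `x ↦ Ax + b`. -/
noncomputable def symLinI (m r : ℕ) (A : Matrix (Fin m) (Fin m) (ZMod 2)) (b : Fin m → ZMod 2) :
    Vr m r →ₗ[ZMod 2] Vr m r :=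
  AddMonoidHom.toZModLinearMap 2 (AddMonoidHom.mk' (symMapI m r A b) (by
    intro c c'
    funext J
    have h1 : degI m r (c + c') = degI m r c + degI m r c' := by
      funext s; by_cases h : wt s = r <;> simp [degI, h]
    have h2 : ∀ u v : Idx m → ZMod 2, evalI m (u + v) = evalI m u + evalI m v := by
      intro u v; funext x; simp [evalI, add_mul, Finset.sum_add_distrib]
    have h4 : ∀ f g : Idx m → ZMod 2, coefI m (f + g) = coefI m f + coefI m g := by
      intro f g; funext s
      simp only [coefI, Pi.add_apply]
      rw [← Finset.sum_add_distrib]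
      refine Finset.sum_congr rfl (fun t _ => ?_)
      by_cases h : (∀ i, t i = 1 → s i = 1)
      · rw [if_pos h, if_pos h, if_pos h]
      · rw [if_neg h, if_neg h, if_neg h]; ring
    show symMapI m r A b (c + c') J = symMapI m r A b c J + symMapI m r A b c' J
    simp only [symMapI, h1, h2]
    have : (fun x => (evalI m (degI m r c) + evalI m (degI m r c')) (A.mulVec x + b))
        = (fun x => evalI m (degI m r c) (A.mulVec x + b))
          + (fun x => evalI m (degI m r c') (A.mulVec x + b)) := rfl
    rw [this, h4]
    rfl))

theorem base_eq_ite (a b : ZMod 2) : base a b = if b = 1 then a else 1 := by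
  revert a b; decide

theorem Gmat_apply_eq_ite {m : ℕ} (s t : Idx m) :
    Gmat m s t = if ∀ i, t i = 1 → s i = 1 then 1 else 0 := by
  have hb : ∀ a b : ZMod 2, base a b = if b = 1 → a = 1 then 1 else 0 := by decide
  simp only [Gmat, hb]
  by_cases h : ∀ i, t i = 1 → s i = 1
  · rw [if_pos h]
    exact Finset.prod_eq_one fun i _ => if_pos (h i)
  · rw [if_neg h]
    push Not at h
    obtain ⟨i, hi, hi'⟩ := h
    exact Finset.prod_eq_zero (Finset.mem_univ i) (by simp [hi, hi'])

theorem coefI_eq_Wfun (m : ℕ) (f : Idx m → ZMod 2) : coefI m f = Wfun m f := by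
  funext s
  simp [coefI, Wfun, Matrix.mulVec, dotProduct, Gmat_apply_eq_ite]

theorem evalI_eq_Wfun (m : ℕ) (c : Idx m → ZMod 2) : evalI m c = Wfun m c := by
  funext x
  simp [evalI, Wfun, Matrix.mulVec, dotProduct, Gmat, base_eq_ite, mul_comm]

theorem Gmat_mul_self (m : ℕ) : Gmat m * Gmat m = 1 := by
  have hb : ∀ a b : ZMod 2, ∑ u, base a u * base u b = if a = b then 1 else 0 := by decide
  ext x y
  have h : (Gmat m * Gmat m) x y = ∏ i, ∑ u, base (x i) u * base u (y i) := by
    rw [Finset.prod_univ_sum, Fintype.piFinset_univ]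
    simp [Matrix.mul_apply, Gmat, Finset.prod_mul_distrib]
  rw [h]
  simp only [hb, Matrix.one_apply]
  by_cases hxy : x = y
  · simp [hxy]
  · rw [if_neg hxy]
    obtain ⟨i, hi⟩ := Function.ne_iff.mp hxy
    exact Finset.prod_eq_zero (Finset.mem_univ i) (if_neg hi)

theorem Wfun_Wfun (m : ℕ) (f : Idx m → ZMod 2) : Wfun m (Wfun m f) = f := by
  simp [Wfun, Matrix.mulVec_mulVec, Gmat_mul_self]

/-- The Boolean functions on `F₂^m` whose multilinear expansion has degree `< k`. -/
def degreeLT (m k : ℕ) : Submodule (ZMod 2) (Idx m → ZMod 2) where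
  carrier := {f | ∀ s, k ≤ wt s → Wfun m f s = 0}
  zero_mem' := by intro s _; simp [Wfun]
  add_mem' := by
    intro f g hf hg s hs
    simp only [Wfun, Matrix.mulVec_add, Pi.add_apply] at hf hg ⊢
    rw [hf s hs, hg s hs, add_zero]
  smul_mem' := by
    intro c f hf s hs
    simp only [Wfun, Matrix.mulVec_smul, Pi.smul_apply] at hf ⊢
    rw [hf s hs, smul_zero]

theorem degreeLT_mono {m k l : ℕ} (h : k ≤ l) : degreeLT m k ≤ degreeLT m l :=
  fun _ hf s hs => hf s (h.trans hs)

theorem Gmat_mul_coord {m : ℕ} (s t : Idx m) (i : Fin m) :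
    Gmat m s t * t i = s i * (Gmat m s t + Gmat m (Function.update s i 0) t) := by
  have hprod : ∏ j ∈ {i}ᶜ, base (Function.update s i 0 j) (t j)
      = ∏ j ∈ {i}ᶜ, base (s j) (t j) :=
    Finset.prod_congr rfl fun j hj => by
      rw [Function.update_of_ne (by simpa using hj)]
  simp only [Gmat]
  rw [Fintype.prod_eq_mul_prod_compl i, Fintype.prod_eq_mul_prod_compl i, hprod,
    Function.update_self]
  have key : ∀ a b p : ZMod 2, base a b * p * b = a * (base a b * p + base 0 b * p) := by decide
  exact key _ _ _

theorem wt_le_wt_update_zero_add_one {m : ℕ} (s : Idx m) (i : Fin m) :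
    wt s ≤ wt (Function.update s i 0) + 1 := by
  have h : Finset.univ.filter (fun j => s j = 1)
      ⊆ insert i (Finset.univ.filter fun j => Function.update s i 0 j = 1) := by
    intro j hj
    by_cases hji : j = i
    · simp [hji]
    · simpa [hji] using hj
  exact (Finset.card_le_card h).trans (Finset.card_insert_le _ _)

theorem coord_mul_mem_degreeLT {m k : ℕ} {f : Idx m → ZMod 2} (hf : f ∈ degreeLT m k)
    (i : Fin m) : (fun x => x i * f x) ∈ degreeLT m (k + 1) := by
  intro s hs
  have h : Wfun m (fun x => x i * f x) s
      = s i * (Wfun m f s + Wfun m f (Function.update s i 0)) := by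
    simp only [Wfun, Matrix.mulVec, dotProduct]
    rw [← Finset.sum_add_distrib, Finset.mul_sum]
    refine Finset.sum_congr rfl fun t _ => ?_
    rw [← mul_assoc, Gmat_mul_coord]
    ring
  have hs' := wt_le_wt_update_zero_add_one s i
  rw [h, hf s (by omega), hf _ (by omega), add_zero, mul_zero]

theorem one_mem_degreeLT (m : ℕ) : (1 : Idx m → ZMod 2) ∈ degreeLT m 1 := by
  have h : (1 : Idx m → ZMod 2) = Wfun m (Pi.single 0 1) := by
    funext x
    simp [Wfun, Gmat, base]
  intro s hs
  rw [h, Wfun_Wfun, Pi.single_eq_of_ne]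
  rintro rfl
  simp [wt] at hs

theorem prod_affine_mem_degreeLT {m : ℕ} (A : Matrix (Fin m) (Fin m) (ZMod 2))
    (b : Fin m → ZMod 2) (S : Finset (Fin m)) :
    (fun x : Idx m => ∏ i ∈ S, (A.mulVec x + b) i) ∈ degreeLT m (S.card + 1) := by
  induction S using Finset.induction_on with
  | empty => exact one_mem_degreeLT m
  | insert i S hi ih =>
    rw [Finset.card_insert_of_notMem hi]
    have h : (fun x : Idx m => ∏ j ∈ insert i S, (A.mulVec x + b) j)
        = (∑ j, A i j • fun x : Idx m => x j * ∏ l ∈ S, (A.mulVec x + b) l)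
          + b i • fun x : Idx m => ∏ l ∈ S, (A.mulVec x + b) l := by
      funext x
      rw [Finset.prod_insert hi]
      simp [Matrix.mulVec, dotProduct, add_mul, Finset.sum_mul, mul_assoc]
    rw [h]
    exact add_mem
      (sum_mem fun j _ => Submodule.smul_mem _ _ (coord_mul_mem_degreeLT ih j))
      (Submodule.smul_mem _ _ (degreeLT_mono (Nat.le_succ _) ih))

/-- Substitution of `x ↦ Ax + b` in Boolean functions. -/
def affineSubst (m : ℕ) (A : Matrix (Fin m) (Fin m) (ZMod 2)) (b : Fin m → ZMod 2) :
    (Idx m → ZMod 2) →ₗ[ZMod 2] (Idx m → ZMod 2) :=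
  LinearMap.funLeft (ZMod 2) (ZMod 2) fun x => A.mulVec x + b

theorem affineSubst_apply {m : ℕ} (A : Matrix (Fin m) (Fin m) (ZMod 2)) (b : Fin m → ZMod 2)
    (f : Idx m → ZMod 2) (x : Idx m) : affineSubst m A b f x = f (A.mulVec x + b) := rfl

/-- An affine substitution does not increase the degree. -/
theorem affineSubst_mem_degreeLT {m k : ℕ} (A : Matrix (Fin m) (Fin m) (ZMod 2))
    (b : Fin m → ZMod 2) {f : Idx m → ZMod 2} (hf : f ∈ degreeLT m k) :
    affineSubst m A b f ∈ degreeLT m k := by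
  have h : affineSubst m A b f = ∑ s, Wfun m f s • fun x : Idx m =>
      ∏ i ∈ Finset.univ.filter (fun i => s i = 1), (A.mulVec x + b) i := by
    funext x
    rw [affineSubst_apply]
    conv_lhs => rw [← Wfun_Wfun m f, ← evalI_eq_Wfun]
    simp [evalI, Finset.prod_filter]
  rw [h]
  refine sum_mem fun s _ => ?_
  by_cases hs : k ≤ wt s
  · rw [hf s hs, zero_smul]
    exact zero_mem _
  · exact Submodule.smul_mem _ _
      (degreeLT_mono (by unfold wt at hs; omega) (prod_affine_mem_degreeLT A b _))

/-- The affine permutation `x ↦ Ax + b` of `F₂^m` for invertible `A`. -/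
noncomputable def affinePerm {m : ℕ} {A : Matrix (Fin m) (Fin m) (ZMod 2)} (hA : IsUnit A)
    (b : Fin m → ZMod 2) : Idx m ≃ Idx m where
  toFun x := A.mulVec x + b
  invFun y := A⁻¹.mulVec y + -A⁻¹.mulVec b
  left_inv x := by
    have := A.nonsing_inv_mul ((A.isUnit_iff_isUnit_det).mp hA)
    simp [Matrix.mulVec_add, Matrix.mulVec_mulVec, this]
  right_inv y := by
    have := A.mul_nonsing_inv ((A.isUnit_iff_isUnit_det).mp hA)
    simp [Matrix.mulVec_add, Matrix.mulVec_neg, Matrix.mulVec_mulVec, this]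

theorem affineSubst_mem_degreeLT_iff {m k : ℕ} {A : Matrix (Fin m) (Fin m) (ZMod 2)}
    (hA : IsUnit A) (b : Fin m → ZMod 2) {f : Idx m → ZMod 2} :
    affineSubst m A b f ∈ degreeLT m k ↔ f ∈ degreeLT m k := by
  refine ⟨fun h => ?_, affineSubst_mem_degreeLT A b⟩
  have hinv : affineSubst m A⁻¹ (-A⁻¹.mulVec b) (affineSubst m A b f) = f := by
    funext y
    exact congrArg f ((affinePerm hA b).right_inv y)
  simpa [hinv] using affineSubst_mem_degreeLT A⁻¹ (-A⁻¹.mulVec b) h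

/-- The coefficients of degree `≥ r` of a Boolean function, split into degree `r` and
degree `> r`. -/
def topCoef (m r : ℕ) :
    (Idx m → ZMod 2) →ₗ[ZMod 2] Vr m r × ({x : Idx m // r < wt x} → ZMod 2) where
  toFun z := (Wr m r z, Wgt m r z)
  map_add' f g := by
    ext <;> simp [Wr, Wgt, Wfun, Matrix.mulVec_add]
  map_smul' c f := by
    ext <;> simp [Wr, Wgt, Wfun, Matrix.mulVec_smul]

/-- The Boolean function with prescribed coefficients in degree `≥ r` and none below. -/
def ofTopCoef (m r : ℕ) :
    Vr m r × ({x : Idx m // r < wt x} → ZMod 2) →ₗ[ZMod 2] (Idx m → ZMod 2) :=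
  (Gmat m).mulVecLin ∘ₗ
    { toFun := fun p => degI m r p.1 + fun s => if h : r < wt s then p.2 ⟨s, h⟩ else 0
      map_add' := by
        intro p q
        funext s
        by_cases h : wt s = r <;> by_cases h' : r < wt s <;> simp [degI, h, h']
      map_smul' := by
        intro c p
        funext s
        by_cases h : wt s = r <;> by_cases h' : r < wt s <;> simp [degI, h, h'] }

theorem ofTopCoef_apply {m r : ℕ} (p : Vr m r × ({x : Idx m // r < wt x} → ZMod 2)) :
    ofTopCoef m r p
      = Wfun m (degI m r p.1 + fun s => if h : r < wt s then p.2 ⟨s, h⟩ else 0) := rfl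

theorem topCoef_ofTopCoef {m r : ℕ} (p : Vr m r × ({x : Idx m // r < wt x} → ZMod 2)) :
    topCoef m r (ofTopCoef m r p) = p := by
  refine Prod.ext (funext fun s => ?_) (funext fun s => ?_)
  · change Wfun m (ofTopCoef m r p) s = _
    rw [ofTopCoef_apply, Wfun_Wfun]
    simp [degI, s.2]
  · change Wfun m (ofTopCoef m r p) s = _
    rw [ofTopCoef_apply, Wfun_Wfun]
    simp [degI, s.2, s.2.ne']

theorem topCoef_eq_zero_iff {m r : ℕ} {f : Idx m → ZMod 2} :
    topCoef m r f = 0 ↔ f ∈ degreeLT m r := by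
  constructor
  · intro h s hs
    rcases hs.eq_or_lt with hs | hs
    · exact congrFun (congrArg Prod.fst h) ⟨s, hs.symm⟩
    · exact congrFun (congrArg Prod.snd h) ⟨s, hs⟩
  · intro h
    exact Prod.ext (funext fun s => h s s.2.ge) (funext fun s => h s s.2.le)

theorem topCoef_snd_eq_zero_iff {m r : ℕ} {f : Idx m → ZMod 2} :
    (topCoef m r f).2 = 0 ↔ f ∈ degreeLT m (r + 1) :=
  ⟨fun h s hs => congrFun h ⟨s, hs⟩, fun h => funext fun s => h s s.2⟩

/-- The action of `x ↦ Ax + b` on coefficients of degree `≥ r`. -/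
def topAction (m r : ℕ) (A : Matrix (Fin m) (Fin m) (ZMod 2)) (b : Fin m → ZMod 2) :
    Vr m r × ({x : Idx m // r < wt x} → ZMod 2) →ₗ[ZMod 2]
      Vr m r × ({x : Idx m // r < wt x} → ZMod 2) :=
  topCoef m r ∘ₗ affineSubst m A b ∘ₗ ofTopCoef m r

theorem topCoef_affineSubst {m : ℕ} (r : ℕ) (A : Matrix (Fin m) (Fin m) (ZMod 2))
    (b : Fin m → ZMod 2) (f : Idx m → ZMod 2) :
    topCoef m r (affineSubst m A b f) = topAction m r A b (topCoef m r f) := by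
  have h : f - ofTopCoef m r (topCoef m r f) ∈ degreeLT m r := by
    rw [← topCoef_eq_zero_iff, map_sub, topCoef_ofTopCoef, sub_self]
  have h' := topCoef_eq_zero_iff.mpr (affineSubst_mem_degreeLT A b h)
  rw [map_sub, map_sub, sub_eq_zero] at h'
  exact h'

theorem topAction_injective {m : ℕ} (r : ℕ) {A : Matrix (Fin m) (Fin m) (ZMod 2)}
    (hA : IsUnit A) (b : Fin m → ZMod 2) : Function.Injective (topAction m r A b) := by
  refine (injective_iff_map_eq_zero _).mpr fun p hp => ?_
  have h := topCoef_eq_zero_iff.mpr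
    ((affineSubst_mem_degreeLT_iff hA b).mp (topCoef_eq_zero_iff.mp hp))
  rwa [topCoef_ofTopCoef] at h

theorem topAction_snd_eq_zero_iff {m r : ℕ} {A : Matrix (Fin m) (Fin m) (ZMod 2)}
    (hA : IsUnit A) (b : Fin m → ZMod 2)
    (p : Vr m r × ({x : Idx m // r < wt x} → ZMod 2)) :
    (topAction m r A b p).2 = 0 ↔ p.2 = 0 := by
  change (topCoef m r (affineSubst m A b (ofTopCoef m r p))).2 = 0 ↔ _
  rw [topCoef_snd_eq_zero_iff, affineSubst_mem_degreeLT_iff hA, ← topCoef_snd_eq_zero_iff,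
    topCoef_ofTopCoef]

theorem topAction_inl {m r : ℕ} {A : Matrix (Fin m) (Fin m) (ZMod 2)}
    (hA : IsUnit A) (b : Fin m → ZMod 2) (c : Vr m r) :
    topAction m r A b (c, 0) = (symLinI m r A b c, 0) := by
  refine Prod.ext (funext fun s => ?_) ((topAction_snd_eq_zero_iff hA b _).mpr rfl)
  change Wfun m (affineSubst m A b (ofTopCoef m r (c, 0))) s = symMapI m r A b c s
  have h : ofTopCoef m r (c, 0) = Wfun m (degI m r c) := by
    rw [ofTopCoef_apply]
    congr 1
    funext s
    simp
  rw [symMapI, coefI_eq_Wfun, evalI_eq_Wfun, h]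
  rfl

theorem symLinI_injective {m : ℕ} (r : ℕ) {A : Matrix (Fin m) (Fin m) (ZMod 2)}
    (hA : IsUnit A) (b : Fin m → ZMod 2) : Function.Injective (symLinI m r A b) := by
  intro c c' h
  have h' : topAction m r A b (c, 0) = topAction m r A b (c', 0) := by
    rw [topAction_inl hA, topAction_inl hA, h]
  exact congrArg Prod.fst (topAction_injective r hA b h')

/-- Entropy is invariant under measure-preserving maps of the probability space and injective
relabelling of the values. -/
theorem ent_congr {Ω Ω' S : Type*} [MeasurableSpace Ω] [MeasurableSpace Ω']
    [DiscreteMeasurableSpace Ω'] [Finite S] {μ : Measure Ω} {ν : Measure Ω'} {f : Ω → Ω'}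
    (hf : MeasurePreserving f μ ν) {φ : S → S} (hφ : Function.Injective φ)
    {X : Ω → S} {Y : Ω' → S} (h : ∀ ω, Y (f ω) = φ (X ω)) : ent μ X = ent ν Y := by
  have key : ∀ s, μ (X ⁻¹' {s}) = ν (Y ⁻¹' {φ s}) := by
    intro s
    rw [← hf.measure_preimage (MeasurableSet.of_discrete).nullMeasurableSet]
    congr 1
    ext ω
    simp [h, hφ.eq_iff]
  unfold ent
  rw [← (Equiv.ofBijective φ (Finite.injective_iff_bijective.mp hφ)).tsum_eq
    fun s => (ν (Y ⁻¹' {s})).toReal * Real.logb 2 (ν (Y ⁻¹' {s})).toReal]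
  simp [key]

theorem measurePreserving_unifM {α β : Type*} [MeasurableSpace α] [MeasurableSpace β]
    [DiscreteMeasurableSpace α] [DiscreteMeasurableSpace β] (e : α ≃ β) :
    MeasurePreserving e (unifM α) (unifM β) := by
  have hcount : ∀ s : Set β, Measure.count (e ⁻¹' s) = Measure.count s := by
    intro s
    rw [Measure.count_apply .of_discrete, Measure.count_apply .of_discrete,
      Set.encard_preimage_of_bijective e.bijective]
  refine ⟨.of_discrete, Measure.ext fun s hs => ?_⟩
  rw [Measure.map_apply .of_discrete hs]
  simp only [unifM, Measure.smul_apply, hcount]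
  rw [← hcount Set.univ, Set.preimage_univ]

instance isFiniteMeasure_bern2 (δ : ℝ) : IsFiniteMeasure (bern2 δ) :=
  ⟨by simp [bern2]⟩

instance isFiniteMeasure_noise (m : ℕ) (δ : ℝ) : IsFiniteMeasure (noise m δ) := by
  unfold noise
  infer_instance

instance sFinite_unifM (α : Type*) [MeasurableSpace α] [Countable α] : SFinite (unifM α) := by
  unfold unifM
  infer_instance

theorem measurePreserving_affineSubst {m : ℕ} (δ : ℝ) {A : Matrix (Fin m) (Fin m) (ZMod 2)}
    (hA : IsUnit A) (b : Fin m → ZMod 2) :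
    MeasurePreserving (affineSubst m A b) (noise m δ) (noise m δ) := by
  have h := measurePreserving_piCongrLeft (α := fun _ : Idx m => ZMod 2)
    (fun _ => bern2 δ) (affinePerm hA b).symm
  have heq : ⇑(MeasurableEquiv.piCongrLeft (fun _ : Idx m => ZMod 2) (affinePerm hA b).symm)
      = affineSubst m A b := by
    funext f x
    obtain ⟨y, rfl⟩ := (affinePerm hA b).symm.surjective x
    rw [MeasurableEquiv.piCongrLeft_apply_apply]
    exact congrArg f ((affinePerm hA b).right_inv y).symm
  rwa [heq] at h


/-- for the automorphism `π` of `F₂^{binom(m,r)}` induced by an invertible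
affine transformation `x ↦ Ax + b`, and any subspace `𝒢 ⊆ F₂^{binom(m,r)}`,
`d(U_𝒢; W_r|W_{>r}) = d(U_{π(𝒢)}; W_r|W_{>r})`, where `U_𝒢` is uniform on `𝒢` and
independent of `W` (independence realized by the product measure). -/
theorem stmt8 (m r : ℕ) (δ : ℝ) (hδ : δ ∈ Set.Ioo 0 (1/2 : ℝ))
    (A : Matrix (Fin m) (Fin m) (ZMod 2)) (hA : IsUnit A) (b : Fin m → ZMod 2)
    (𝒢 : Submodule (ZMod 2) (Vr m r)) :
    condRdist (unifM ↥𝒢) (noise m δ)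
        (fun g => (g : Vr m r)) (fun _ => ()) (Wr m r) (Wgt m r)
      = condRdist (unifM ↥(Submodule.map (symLinI m r A b) 𝒢)) (noise m δ)
        (fun g => (g : Vr m r)) (fun _ => ()) (Wr m r) (Wgt m r) := by
  let e : 𝒢 ≃ Submodule.map (symLinI m r A b) 𝒢 :=
    (Submodule.equivMapOfInjective _ (symLinI_injective r hA b) 𝒢).toEquiv
  have he : ∀ g : 𝒢, (e g : Vr m r) = symLinI m r A b g := fun g => rfl
  have hU := measurePreserving_unifM e
  have hUW := hU.prod (measurePreserving_affineSubst δ hA b)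
  have hgt : ∀ z, Wgt m r (affineSubst m A b z) = (topAction m r A b (0, Wgt m r z)).2 := by
    intro z
    have h1 : Wgt m r (affineSubst m A b z) = (topAction m r A b (topCoef m r z)).2 :=
      congrArg Prod.snd (topCoef_affineSubst r A b z)
    rw [h1, ← sub_eq_zero, ← Prod.snd_sub, ← map_sub, topAction_snd_eq_zero_iff hA]
    exact sub_self _
  have hinj : Function.Injective
      fun v : {x : Idx m // r < wt x} → ZMod 2 => (topAction m r A b (0, v)).2 := by
    intro v v' h
    rw [← sub_eq_zero, ← Prod.snd_sub, ← map_sub, topAction_snd_eq_zero_iff hA] at h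
    exact sub_eq_zero.mp h
  have hsum : ∀ (g : 𝒢) z,
      ((e g : Vr m r) + Wr m r (affineSubst m A b z), Wgt m r (affineSubst m A b z))
        = topAction m r A b ((g : Vr m r) + Wr m r z, Wgt m r z) := by
    intro g z
    have h1 : ((g : Vr m r) + Wr m r z, Wgt m r z) = ((g : Vr m r), 0) + topCoef m r z := by
      simp [topCoef]
    rw [h1, map_add, topAction_inl hA, ← topCoef_affineSubst, he]
    simp [topCoef]
  have hjoint : ent ((unifM 𝒢).prod (noise m δ))
        (fun ω => ((ω.1 : Vr m r) + Wr m r ω.2, ((), Wgt m r ω.2)))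
      = ent ((unifM (Submodule.map (symLinI m r A b) 𝒢)).prod (noise m δ))
        (fun ω => ((ω.1 : Vr m r) + Wr m r ω.2, ((), Wgt m r ω.2))) := by
    refine ent_congr hUW (φ := fun p => ((topAction m r A b (p.1, p.2.2)).1,
      ((), (topAction m r A b (p.1, p.2.2)).2))) ?_ ?_
    · rintro ⟨c, _, v⟩ ⟨c', _, v'⟩ h
      simp only [Prod.mk.injEq, true_and] at h
      simpa using topAction_injective r hA b (Prod.ext h.1 h.2)
    · rintro ⟨g, z⟩
      simp only [← hsum, Prod.map]
  have hcond : ent ((unifM 𝒢).prod (noise m δ)) (fun ω => ((), Wgt m r ω.2))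
      = ent ((unifM (Submodule.map (symLinI m r A b) 𝒢)).prod (noise m δ))
        (fun ω => ((), Wgt m r ω.2)) := by
    refine ent_congr hUW (Function.injective_id.prodMap hinj) ?_
    rintro ⟨g, z⟩
    simp [Prod.map, hgt]
  have hunif : ent (unifM 𝒢) (fun g => ((g : Vr m r), ()))
      = ent (unifM (Submodule.map (symLinI m r A b) 𝒢)) (fun g => ((g : Vr m r), ())) :=
    ent_congr hU ((symLinI_injective r hA b).prodMap Function.injective_id) fun g => rfl
  have htriv : ent (unifM 𝒢) (fun _ => ())
      = ent (unifM (Submodule.map (symLinI m r A b) 𝒢)) (fun _ => ()) :=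
    ent_congr hU Function.injective_id fun g => rfl
  simp only [condRdist, condEnt]
  rw [hjoint, hcond, hunif, htriv]
end
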